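/- arXiv:1404.4306 — 2 statements merged into one kernel-verified Lean document; each statement's English description precedes it below -/
import Mathlib

section
/- For every u ∈ L^Φ, the three quantities θ_Φ(u) = inf{λ>0 : I_Φ(u/λ) < ∞}, Q_Φ(u) = sup{ inf_n ‖u_n‖_Φ : |u| ≥ u_n ↓ 0 }, and Q_{Φ,0}(u) = sup{ inf_n ‖u_n‖_{Φ,0} : |u| ≥ u_n ↓ 0 } coincide. -/
open MeasureTheory ENNReal NNReal Filter Topology

noncomputable section

/-- A measure is non-atomic if every set of positive measure contains a
measurable subset of strictly smaller positive measure. -/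
def IsNonatomic {T : Type*} [MeasurableSpace T] (μ : Measure T) : Prop :=
  ∀ s : Set T, MeasurableSet s → 0 < μ s →
    ∃ t : Set T, t ⊆ s ∧ MeasurableSet t ∧ 0 < μ t ∧ μ t < μ s

/-- A Musielak--Orlicz function on `(T, Σ, μ)`. -/
structure MOFunction (T : Type*) [MeasurableSpace T] (μ : Measure T) where
  toFun : T → ℝ≥0∞ → ℝ≥0∞
  measurable' : ∀ u : ℝ≥0∞, Measurable fun t => toFun t u
  convex' : ∀ᵐ t ∂μ, ∀ a b : ℝ≥0∞, ∀ p : ℝ≥0, p ≤ 1 →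
    toFun t (p • a + (1 - p) • b) ≤ p • toFun t a + (1 - p) • toFun t b
  lsc' : ∀ᵐ t ∂μ, LowerSemicontinuous (toFun t)
  zero' : ∀ᵐ t ∂μ, toFun t 0 = 0
  limZero' : ∀ᵐ t ∂μ, Tendsto (toFun t) (nhdsWithin 0 (Set.Ioi 0)) (nhds 0)
  top' : ∀ᵐ t ∂μ, toFun t ⊤ = ⊤

namespace MOFunction

variable {T : Type*} [MeasurableSpace T] {μ : Measure T}

/-- Left derivative of a (convex) function `φ : ℝ≥0∞ → ℝ≥0∞`, with the
convention that it vanishes at `0`. -/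
def leftDeriv (φ : ℝ≥0∞ → ℝ≥0∞) (u : ℝ≥0∞) : ℝ≥0∞ :=
  ⨆ x ∈ Set.Iio u, (φ u - φ x) / (u - x)

/-- Right derivative of a (convex) function `φ : ℝ≥0∞ → ℝ≥0∞`. -/
def rightDeriv (φ : ℝ≥0∞ → ℝ≥0∞) (u : ℝ≥0∞) : ℝ≥0∞ :=
  ⨅ x ∈ Set.Ioi u, (φ x - φ u) / (x - u)

/-- The complementary (Young conjugate) function `Φ*`. -/
def conj (P : MOFunction T μ) : T → ℝ≥0∞ → ℝ≥0∞ :=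
  fun t v => ⨆ u ∈ Set.Ioi (0 : ℝ≥0∞), u * v - P.toFun t u

/-- The modular `I_Φ(u) = ∫ Φ(t, |u(t)|) dμ`. -/
def modular (P : MOFunction T μ) (u : T → ℝ) : ℝ≥0∞ :=
  ∫⁻ t, P.toFun t (ENNReal.ofReal |u t|) ∂μ

/-- The modular of the complementary function, `I_{Φ*}`. -/
def modularConj (P : MOFunction T μ) (v : T → ℝ) : ℝ≥0∞ :=
  ∫⁻ t, P.conj t (ENNReal.ofReal |v t|) ∂μ

/-- Membership in the Musielak--Orlicz space `L^Φ`. -/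
def memLPhi (P : MOFunction T μ) (u : T → ℝ) : Prop :=
  Measurable u ∧ ∃ l : ℝ, 0 < l ∧ P.modular (fun t => l * u t) < ⊤

/-- Membership in `L^{Φ*}`. -/
def memLPhiConj (P : MOFunction T μ) (v : T → ℝ) : Prop :=
  Measurable v ∧ ∃ l : ℝ, 0 < l ∧ P.modularConj (fun t => l * v t) < ⊤

/-- The Luxemburg norm on `L^Φ`. -/
def luxNorm (P : MOFunction T μ) (u : T → ℝ) : ℝ :=
  sInf {l : ℝ | 0 < l ∧ P.modular (fun t => u t / l) ≤ 1}

/-- The Luxemburg norm on `L^{Φ*}`. -/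
def luxNormConj (P : MOFunction T μ) (v : T → ℝ) : ℝ :=
  sInf {l : ℝ | 0 < l ∧ P.modularConj (fun t => v t / l) ≤ 1}

/-- The Orlicz norm on `L^Φ`. -/
def orliczNorm (P : MOFunction T μ) (u : T → ℝ) : ℝ :=
  sSup {r : ℝ | ∃ v : T → ℝ, Measurable v ∧ P.modularConj v ≤ 1 ∧
    r = |∫ t, u t * v t ∂μ|}

/-- The Orlicz norm on `L^{Φ*}`. -/
def orliczNormConj (P : MOFunction T μ) (v : T → ℝ) : ℝ :=
  sSup {r : ℝ | ∃ u : T → ℝ, Measurable u ∧ P.modular u ≤ 1 ∧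
    r = |∫ t, u t * v t ∂μ|}

/-- The Amemiya functional `inf_{k>0} (1 + I_Φ(ku))/k` (equal to the Orlicz
norm). -/
def amemiya (P : MOFunction T μ) (u : T → ℝ) : ℝ≥0∞ :=
  ⨅ k ∈ Set.Ioi (0 : ℝ), (1 + P.modular (fun t => k * u t)) / ENNReal.ofReal k

/-- The set `K(u)` of positive numbers attaining the infimum in the Amemiya
norm. -/
def Kset (P : MOFunction T μ) (u : T → ℝ) : Set ℝ :=
  {k | 0 < k ∧ (1 + P.modular (fun t => k * u t)) / ENNReal.ofReal k = P.amemiya u}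

/-- `k_u^* = inf{k > 0 : I_{Φ*}(Φ'_+(t, |k u(t)|)) ≥ 1}`. -/
def kStar (P : MOFunction T μ) (u : T → ℝ) : ℝ :=
  sInf {k : ℝ | 0 < k ∧
    1 ≤ ∫⁻ t, P.conj t (rightDeriv (P.toFun t) (ENNReal.ofReal (k * |u t|))) ∂μ}

/-- `b_{Φ*}(t) = sup{v ≥ 0 : Φ*(t,v) < ∞}`. -/
def bConj (P : MOFunction T μ) (t : T) : ℝ≥0∞ :=
  sSup {v : ℝ≥0∞ | P.conj t v < ⊤}

/-- `a_{Φ*}(t) = sup{v ≥ 0 : Φ*(t,v) = 0}`. -/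
def aConj (P : MOFunction T μ) (t : T) : ℝ≥0∞ :=
  sSup {v : ℝ≥0∞ | P.conj t v = 0}

/-- The `Δ₂`-condition. -/
def Delta2 (P : MOFunction T μ) : Prop :=
  ∃ (K : ℝ≥0∞) (f : T → ℝ≥0∞), Measurable f ∧ (∫⁻ t, P.toFun t (f t) ∂μ) < ⊤ ∧
    ∀ᵐ t ∂μ, ∀ u : ℝ≥0∞, f t ≤ u → P.toFun t (2 * u) ≤ K * P.toFun t u

/-- Dual norm of a functional with respect to the Luxemburg norm. -/
def dualNormLux (P : MOFunction T μ) (f : (T → ℝ) →ₗ[ℝ] ℝ) : ℝ :=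
  sSup {r : ℝ | ∃ u : T → ℝ, P.memLPhi u ∧ P.luxNorm u ≤ 1 ∧ r = |f u|}

/-- Dual norm of a functional with respect to the Orlicz norm. -/
def dualNormOrlicz (P : MOFunction T μ) (f : (T → ℝ) →ₗ[ℝ] ℝ) : ℝ :=
  sSup {r : ℝ | ∃ u : T → ℝ, P.memLPhi u ∧ P.orliczNorm u ≤ 1 ∧ r = |f u|}

/-- The order continuous part `f_c(u) = inf{sup_n f(u_n) : 0 ≤ u_n ↑ u}` of a
(positive) functional, evaluated at a nonnegative `u`. -/
def orderContPart (P : MOFunction T μ) (f : (T → ℝ) →ₗ[ℝ] ℝ) (u : T → ℝ) : ℝ :=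
  sInf {c : ℝ | ∃ w : ℕ → T → ℝ, (∀ n t, 0 ≤ w n t) ∧
    (∀ n t, w n t ≤ w (n + 1) t) ∧
    (∀ t, Tendsto (fun n => w n t) atTop (nhds (u t))) ∧ c = ⨆ n, f (w n)}

/-- A functional is purely singular if its order continuous component
vanishes. -/
def PurelySingular (P : MOFunction T μ) (f : (T → ℝ) →ₗ[ℝ] ℝ) : Prop :=
  ∀ u : T → ℝ, P.memLPhi u → (∀ t, 0 ≤ u t) → P.orderContPart f u = 0

/-- `f` is a support functional at `u` in `L_0^Φ`. -/
def IsSupportAt (P : MOFunction T μ) (f : (T → ℝ) →ₗ[ℝ] ℝ) (u : T → ℝ) : Prop :=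
  P.dualNormOrlicz f = 1 ∧ f u = P.orliczNorm u

/-- `u` is a smooth point of `L_0^Φ`: it has exactly one support functional
(as a functional on `L^Φ`). -/
def IsSmoothPoint (P : MOFunction T μ) (u : T → ℝ) : Prop :=
  (∃ f : (T → ℝ) →ₗ[ℝ] ℝ, P.IsSupportAt f u) ∧
    ∀ f g : (T → ℝ) →ₗ[ℝ] ℝ, P.IsSupportAt f u → P.IsSupportAt g u →
      ∀ w : T → ℝ, P.memLPhi w → f w = g w

/-- `θ_Φ(u) = inf{λ > 0 : I_Φ(u/λ) < ∞}`. -/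
def thetaPhi (P : MOFunction T μ) (u : T → ℝ) : ℝ :=
  sInf {l : ℝ | 0 < l ∧ P.modular (fun t => u t / l) < ⊤}

end MOFunction

open MOFunction

variable {T : Type*} [MeasurableSpace T] {μ : Measure T}


namespace MOFunction

lemma ae_scale (P : MOFunction T μ) : ∀ᵐ t ∂μ, ∀ (p : ℝ≥0) (a : ℝ≥0∞), p ≤ 1 →
    P.toFun t (p * a) ≤ p * P.toFun t a := by
  filter_upwards [P.convex', P.zero'] with t hc h0 p a hp
  have := hc a 0 p hp
  simpa [h0, ENNReal.smul_def] using this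

lemma ae_mono (P : MOFunction T μ) : ∀ᵐ t ∂μ, Monotone (P.toFun t) := by
  filter_upwards [P.ae_scale, P.top', P.zero'] with t hs ht h0 a b hab
  rcases eq_or_ne b ⊤ with rfl | hb
  · simp [ht]
  rcases eq_or_ne b 0 with rfl | hb0
  · simp_all
  lift b to ℝ≥0 using hb
  lift a to ℝ≥0 using (lt_of_le_of_lt hab (by simp)).ne
  have hb' : b ≠ 0 := by simpa using hb0
  have hab' : a ≤ b := by simpa using hab
  have hp : a / b ≤ 1 := div_le_one_of_le₀ hab' (by simp)
  have := hs (a / b) b hp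
  rw [← ENNReal.coe_mul, div_mul_cancel₀ _ hb'] at this
  refine this.trans ?_
  calc _ ≤ (1 : ℝ≥0∞) * P.toFun t b := by gcongr; exact_mod_cast hp
    _ = _ := one_mul _

lemma aemeas (P : MOFunction T μ) {w : T → ℝ≥0∞} (hw : Measurable w) :
    AEMeasurable (fun t => P.toFun t (w t)) μ := by
  refine ⟨fun t => ⨆ q : ℚ, {t | ENNReal.ofReal q < w t}.indicator
    (fun t => P.toFun t (ENNReal.ofReal q)) t, ?_, ?_⟩
  · refine Measurable.iSup fun q => ?_
    exact (P.measurable' _).indicator (measurableSet_lt measurable_const hw)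
  · filter_upwards [P.ae_mono, P.lsc', P.zero'] with t hm hl h0
    apply le_antisymm
    · refine le_of_forall_lt fun c hc => ?_
      have hpos : 0 < w t := by
        rcases eq_or_ne (w t) 0 with h | h
        · rw [h, h0] at hc; simp at hc
        · exact pos_iff_ne_zero.2 h
      have hev := hl (w t) c hc
      obtain ⟨l, hl1, hl2⟩ := exists_Ioc_subset_of_mem_nhds hev ⟨0, hpos⟩
      obtain ⟨q, hq0, hq1, hq2⟩ := ENNReal.lt_iff_exists_rat_btwn.1 hl1
      have hq2' : ENNReal.ofReal q < w t := hq2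
      have hq3 : c < P.toFun t (ENNReal.ofReal q) := hl2 ⟨hq1, hq2'.le⟩
      refine hq3.trans_le ?_
      refine le_iSup_of_le q ?_
      rw [Set.indicator_of_mem (by exact hq2')]
    · refine iSup_le fun q => ?_
      by_cases h : ENNReal.ofReal q < w t
      · rw [Set.indicator_of_mem (by exact h)]; exact hm h.le
      · rw [Set.indicator_of_notMem (by exact h)]; exact zero_le

lemma ae_young (P : MOFunction T μ) : ∀ᵐ t ∂μ, ∀ a b : ℝ≥0∞,
    a * b ≤ P.toFun t a + P.conj t b := by
  filter_upwards with t a b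
  rcases eq_or_ne a 0 with rfl | ha
  · simp
  rw [← tsub_le_iff_left]
  exact le_iSup₂_of_le (f := fun u (_ : u ∈ Set.Ioi (0:ℝ≥0∞)) => u * b - P.toFun t u)
    a (pos_iff_ne_zero.2 ha) le_rfl

lemma ae_conj_le (P : MOFunction T μ) : ∀ᵐ t ∂μ, ∀ y v : ℝ≥0, (y * v : ℝ≥0∞) ≤ P.toFun t y →
    (y = 0 → v = 0) → P.conj t v ≤ y * v := by
  filter_upwards [P.ae_scale, P.top', P.zero'] with t hs ht h0 y v hyv hy0
  refine iSup₂_le fun s hs0 => ?_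
  rcases eq_or_ne y 0 with rfl | hy
  · simp [hy0 rfl]
  rcases le_total s y with h | h
  · exact tsub_le_self.trans (by gcongr)
  rcases eq_or_ne s ⊤ with rfl | hst
  · simp [ht]
  lift s to ℝ≥0 using hst
  have hs0' : s ≠ 0 := by
    have : (0:ℝ≥0∞) < s := hs0
    simpa [pos_iff_ne_zero] using this
  have h' : y ≤ s := by simpa using h
  have hp : y / s ≤ 1 := div_le_one_of_le₀ h' (by simp)
  have h1 := hs (y / s) s hp
  rw [← ENNReal.coe_mul, div_mul_cancel₀ _ hs0'] at h1
  have h2 := hyv.trans h1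
  have h3 : ((y / s : ℝ≥0) : ℝ≥0∞) * (s * v) ≤ (y / s : ℝ≥0) * P.toFun t s := by
    rw [← mul_assoc, ← ENNReal.coe_mul (y / s), div_mul_cancel₀ _ hs0']; exact h2
  have hne : ((y / s : ℝ≥0) : ℝ≥0∞) ≠ 0 := by
    simp [hy, hs0']
  have h4 := (ENNReal.mul_le_mul_iff_right hne ENNReal.coe_ne_top).1 h3
  rw [tsub_eq_zero_of_le h4]; exact zero_le

lemma modular_mono (P : MOFunction T μ) {u w : T → ℝ} (h : ∀ t, |u t| ≤ |w t|) :
    P.modular u ≤ P.modular w := by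
  refine lintegral_mono_ae ?_
  filter_upwards [P.ae_mono] with t hm
  exact hm (ENNReal.ofReal_le_ofReal (h t))

/-- scaling down a finite modular below one -/
lemma exists_modular_le_one (P : MOFunction T μ) {u : T → ℝ} {l : ℝ} (hl : 0 < l)
    (hm : P.modular (fun t => u t / l) < ⊤) :
    ∃ l' : ℝ, 0 < l' ∧ P.modular (fun t => u t / l') ≤ 1 := by
  set m := P.modular (fun t => u t / l) with hmdef
  lift m to ℝ≥0 using hm.ne with m0 hm0
  have hc : 0 < (m0 + 1) := by positivity
  refine ⟨l * (m0 + 1), by positivity, ?_⟩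
  have hp : (m0 + 1)⁻¹ ≤ 1 := inv_le_one_of_one_le₀ (by simp)
  have : P.modular (fun t => u t / (l * (m0 + 1))) ≤ ((m0 + 1)⁻¹ : ℝ≥0) * P.modular (fun t => u t / l) := by
    unfold modular
    rw [← lintegral_const_mul' _ _ ENNReal.coe_ne_top]
    refine lintegral_mono_ae ?_
    filter_upwards [P.ae_scale] with t hs
    refine le_trans (le_of_eq ?_) (hs _ _ hp)
    congr 1
    rw [← ENNReal.ofReal_coe_nnreal, ← ENNReal.ofReal_mul (by positivity)]
    congr 1
    push_cast
    rw [← abs_of_nonneg (a := ((m0:ℝ) + 1)⁻¹) (by positivity), ← abs_mul]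
    congr 1
    field_simp
  refine this.trans ?_
  rw [← hmdef, ← ENNReal.coe_mul]
  have : (m0 + 1)⁻¹ * m0 ≤ 1 := by
    rw [inv_mul_le_iff₀ hc]; simp
  exact_mod_cast this

lemma orlicz_upper (P : MOFunction T μ) {w v : T → ℝ} (hw : Measurable w) (hv : Measurable v)
    {l : ℝ} (hl : 0 < l) (hm : P.modular (fun t => w t / l) < ⊤) (hc : P.modularConj v ≤ 1) :
    |∫ t, w t * v t ∂μ| ≤ l * ((P.modular (fun t => w t / l)).toReal + 1) := by
  have h1 : ∫⁻ t, ‖w t * v t‖ₑ ∂μ ≤ ENNReal.ofReal l * (P.modular (fun t => w t / l) + 1) := by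
    calc ∫⁻ t, ‖w t * v t‖ₑ ∂μ ≤ ∫⁻ t, ENNReal.ofReal l * (P.toFun t (ENNReal.ofReal |w t / l|) +
          P.conj t (ENNReal.ofReal |v t|)) ∂μ := by
          refine lintegral_mono_ae ?_
          filter_upwards [P.ae_young] with t hy
          refine le_trans (le_of_eq ?_) (mul_le_mul_right (hy _ _) _)
          rw [← ENNReal.ofReal_mul (abs_nonneg _), ← ENNReal.ofReal_mul hl.le,
            Real.enorm_eq_ofReal_abs, abs_mul, abs_div, abs_of_pos hl]
          congr 1
          field_simp
      _ = ENNReal.ofReal l * (P.modular (fun t => w t / l) + P.modularConj v) := by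
          rw [lintegral_const_mul' _ _ ENNReal.ofReal_ne_top, lintegral_add_left']
          · rfl
          · exact P.aemeas (by fun_prop)
      _ ≤ _ := by gcongr
  have h2 : ENNReal.ofReal l * (P.modular (fun t => w t / l) + 1) ≠ ⊤ :=
    ENNReal.mul_ne_top ENNReal.ofReal_ne_top (by simp [hm.ne])
  have h3 := (enorm_integral_le_lintegral_enorm (μ := μ) (fun t => w t * v t)).trans h1
  have h4 := ENNReal.toReal_mono h2 h3
  rw [ENNReal.toReal_mul, ENNReal.toReal_ofReal hl.le, ENNReal.toReal_add hm.ne (by simp),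
    toReal_enorm, Real.norm_eq_abs] at h4
  simpa using h4

lemma luxNorm_nonneg (P : MOFunction T μ) (u : T → ℝ) : 0 ≤ P.luxNorm u :=
  Real.sInf_nonneg fun _ h => h.1.le

lemma orliczNorm_nonneg (P : MOFunction T μ) (u : T → ℝ) : 0 ≤ P.orliczNorm u := by
  refine Real.sSup_nonneg ?_
  rintro _ ⟨v, -, -, rfl⟩
  exact abs_nonneg _

lemma orliczNorm_le (P : MOFunction T μ) {w : T → ℝ} (hw : Measurable w)
    {l : ℝ} (hl : 0 < l) (hm : P.modular (fun t => w t / l) < ⊤) :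
    P.orliczNorm w ≤ l * ((P.modular (fun t => w t / l)).toReal + 1) := by
  refine Real.sSup_le ?_ (by positivity)
  rintro _ ⟨v, hv, hc, rfl⟩
  exact P.orlicz_upper hw hv hl hm hc

lemma luxNorm_le (P : MOFunction T μ) {w : T → ℝ} 
    {l : ℝ} (hl : 0 < l) (hm : P.modular (fun t => w t / l) ≤ 1) :
    P.luxNorm w ≤ l := csInf_le ⟨0, fun _ h => h.1.le⟩ ⟨hl, hm⟩

lemma modular_tendsto (P : MOFunction T μ) {u : T → ℝ} (hu : Measurable u) {l : ℝ} (hl : 0 < l)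
    (hm : P.modular (fun t => u t / l) < ⊤) {un : ℕ → T → ℝ} (hun : ∀ n, Measurable (un n))
    (hb : ∀ n t, 0 ≤ un n t ∧ un n t ≤ |u t|) 
    (ht : ∀ t, Tendsto (fun n => un n t) atTop (nhds 0)) :
    Tendsto (fun n => P.modular (fun t => un n t / l)) atTop (nhds 0) := by
  have := tendsto_lintegral_of_dominated_convergence' (μ := μ)
    (F := fun n t => P.toFun t (ENNReal.ofReal |un n t / l|)) (f := fun _ => 0)
    (fun t => P.toFun t (ENNReal.ofReal |u t / l|))
    (fun n => P.aemeas (by have := hun n; fun_prop)) ?_ hm.ne ?_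
  · simpa [modular] using this
  · intro n
    filter_upwards [P.ae_mono] with t hmo
    refine hmo (ENNReal.ofReal_le_ofReal ?_)
    rw [abs_div, abs_div, abs_of_nonneg (hb n t).1]
    gcongr
    exact (hb n t).2
  · filter_upwards [P.limZero', P.zero'] with t hlim h0
    have h1 : Tendsto (P.toFun t) (nhds 0) (nhds 0) := by
      have hsup : nhds (0 : ℝ≥0∞) = nhdsWithin 0 {0}ᶜ ⊔ pure 0 := (nhdsNE_sup_pure 0).symm
      nth_rewrite 1 [hsup]
      refine Tendsto.sup ?_ ?_
      · have : ({0}ᶜ : Set ℝ≥0∞) = Set.Ioi 0 := by ext; simp [pos_iff_ne_zero]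
        rw [this]; exact hlim
      · rw [tendsto_pure_left]; intro s hs; rw [h0]; exact mem_of_mem_nhds hs
    refine h1.comp ?_
    have h2 : Tendsto (fun n => |un n t / l|) atTop (nhds 0) := by
      have := ((ht t).div_const l).abs
      simpa using this
    simpa using ENNReal.tendsto_ofReal h2

lemma luxNorm_lower (P : MOFunction T μ) {w : T → ℝ} {l a : ℝ} (hl : 0 < l)
    (hm : P.modular (fun t => w t / l) < ⊤) (ha : 0 < a) (hi : P.modular (fun t => w t / a) = ⊤) :
    a ≤ P.luxNorm w := by
  refine le_csInf (P.exists_modular_le_one hl hm) ?_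
  rintro b ⟨hb, hb1⟩
  by_contra! h
  have : P.modular (fun t => w t / a) ≤ P.modular (fun t => w t / b) := by
    refine P.modular_mono fun t => ?_
    rw [abs_div, abs_div, abs_of_pos ha, abs_of_pos hb]
    gcongr
  rw [hi] at this
  exact absurd (this.trans hb1) (by simp)

lemma exists_density [SigmaFinite μ] {F : T → ℝ≥0∞} (hF : ∫⁻ t, F t ∂μ = ⊤) :
    ∃ h : T → ℝ≥0, Measurable h ∧ (∀ t, h t ≤ F t) ∧ ∫⁻ t, h t ∂μ = 1 := by
  have h1 : (1 : ℝ≥0∞) < ∫⁻ t, F t ∂μ := by simp [hF]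
  rw [lintegral_eq_nnreal] at h1
  simp only [lt_iSup_iff] at h1
  obtain ⟨f, hf, hf1⟩ := h1
  rw [← SimpleFunc.lintegral_eq_lintegral] at hf1
  obtain ⟨g, hgf, hgt, hg1⟩ := SimpleFunc.exists_lt_lintegral_simpleFunc_of_lt_lintegral (f := f) (L := 1)
    (by simpa using hf1)
  set H := ∫⁻ t, g t ∂μ with hH
  lift H to ℝ≥0 using hgt.ne with H0 hH0
  have h1 : 1 < H0 := by exact_mod_cast hg1
  refine ⟨fun t => H0⁻¹ * g t, g.measurable.const_mul _, fun t => ?_, ?_⟩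
  · refine le_trans ?_ (hf t)
    have h2 : H0⁻¹ * g t ≤ 1 * f t := mul_le_mul' (inv_le_one_of_one_le₀ h1.le) (hgf t)
    rw [one_mul] at h2
    exact_mod_cast h2
  · simp only [ENNReal.coe_mul]
    rw [lintegral_const_mul' _ _ ENNReal.coe_ne_top, ← hH, ← ENNReal.coe_mul,
      inv_mul_cancel₀ (by positivity)]
    simp

lemma orliczNorm_lower [SigmaFinite μ] (P : MOFunction T μ) {w : T → ℝ} (hw : Measurable w)
    (hw0 : ∀ t, 0 ≤ w t) {l a : ℝ} (hl : 0 < l)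
    (hm : P.modular (fun t => w t / l) < ⊤) (ha : 0 < a) (hi : P.modular (fun t => w t / a) = ⊤) :
    a ≤ P.orliczNorm w := by
  obtain ⟨h, hh, hle, h1⟩ := exists_density hi
  have hzero : ∀ᵐ t ∂μ, w t = 0 → h t = 0 := by
    filter_upwards [P.zero'] with t h0 hwt
    have := hle t
    simpa [hwt, h0] using this
  refine le_csSup ⟨l * ((P.modular (fun t => w t / l)).toReal + 1), ?_⟩ ?_
  · rintro _ ⟨v, hv, hc, rfl⟩
    exact P.orlicz_upper hw hv hl hm hc
  · refine ⟨fun t => h t / (w t / a), by fun_prop, ?_, ?_⟩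
    · rw [← h1]
      refine lintegral_mono_ae ?_
      filter_upwards [P.ae_conj_le, hzero] with t hc hz
      have hy : 0 ≤ w t / a := div_nonneg (hw0 t) ha.le
      set y : ℝ≥0 := ⟨w t / a, hy⟩ with hydef
      have e1 : ENNReal.ofReal |w t / a| = y := by
        rw [abs_of_nonneg hy, ENNReal.ofReal_eq_coe_nnreal hy]; rfl
      have e2 : ENNReal.ofReal |(h t : ℝ) / (w t / a)| = ((h t / y : ℝ≥0) : ℝ≥0∞) := by
        rw [abs_of_nonneg (by positivity), ENNReal.ofReal_eq_coe_nnreal (by positivity)]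
        rfl
      have hz' : y = 0 → h t = 0 := by
        intro hy0
        apply hz
        have : w t / a = 0 := congrArg NNReal.toReal hy0
        simpa [ha.ne'] using this
      have e3 : y * (h t / y) = h t := by
        by_cases hy0 : y = 0
        · simp [hz' hy0]
        · field_simp
      have e4 : (y * (h t / y : ℝ≥0) : ℝ≥0∞) = h t := by
        rw [← ENNReal.coe_mul, e3]
      rw [e2, ← e4]
      refine hc _ _ ?_ ?_
      · rw [e4, ← e1]; exact hle t
      · intro hy0; simp [hy0]
    · have : ∫ t, w t * (h t / (w t / a)) ∂μ = ∫ t, a * (h t : ℝ) ∂μ := by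
        refine integral_congr_ae ?_
        filter_upwards [hzero] with t hz
        by_cases hwt : w t = 0
        · simp [hz hwt, hwt]
        · field_simp
      rw [this, integral_const_mul, integral_eq_lintegral_of_nonneg_ae]
      · simp [h1, abs_of_pos ha]
      · exact ae_of_all _ fun t => (h t).2
      · exact (by fun_prop : Measurable fun t => (h t : ℝ)).aestronglyMeasurable

lemma exists_half (hna : IsNonatomic μ) {s : Set T} (hs : MeasurableSet s) (h0 : 0 < μ s) :
    ∃ t ⊆ s, MeasurableSet t ∧ 0 < μ t ∧ μ t ≤ μ s / 2 ∧ μ t < ⊤ := by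
  obtain ⟨t, hts, ht, ht0, htlt⟩ := hna s hs h0
  have hfin : μ t < ⊤ := htlt.trans_le le_top
  by_cases h : μ t ≤ μ s / 2
  · exact ⟨t, hts, ht, ht0, h, hfin⟩
  push Not at h
  have hd : μ (s \ t) = μ s - μ t := measure_sdiff hts ht.nullMeasurableSet hfin.ne
  have hst : μ s < ⊤ := by
    by_contra h'
    have : μ s = ⊤ := by simpa using h'
    rw [this] at h
    simp [ENNReal.top_div] at h
  refine ⟨s \ t, Set.sdiff_subset, hs.diff ht, ?_, ?_, ?_⟩
  · rw [hd]; exact tsub_pos_of_lt htlt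
  · rw [hd, tsub_le_iff_right]
    calc μ s = μ s / 2 + μ s / 2 := (ENNReal.add_halves _).symm
      _ ≤ _ := by gcongr
  · exact (measure_mono Set.sdiff_subset).trans_lt hst

lemma exists_vanishing (hna : IsNonatomic μ) {s : Set T} (hs : MeasurableSet s) (h0 : 0 < μ s) :
    ∃ A : ℕ → Set T, (∀ n, MeasurableSet (A n)) ∧ Antitone A ∧ (⋂ n, A n) = ∅ ∧
      ∀ n, A n ⊆ s ∧ 0 < μ (A n) := by
  classical
  let X := {t : Set T // MeasurableSet t ∧ 0 < μ t}
  have hstep : ∀ x : X, ∃ y : X, y.1 ⊆ x.1 ∧ μ y.1 ≤ μ x.1 / 2 ∧ μ y.1 < ⊤ := by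
    rintro ⟨x, hx, hx0⟩
    obtain ⟨t, h1, h2, h3, h4, h5⟩ := exists_half hna hx hx0
    exact ⟨⟨t, h2, h3⟩, h1, h4, h5⟩
  choose f hf1 hf2 hf3 using hstep
  let x0 : X := f ⟨s, hs, h0⟩
  let B : ℕ → X := fun n => f^[n] x0
  have hB : ∀ n, B (n + 1) = f (B n) := fun n => Function.iterate_succ_apply' f n x0
  have hanti : Antitone fun n => (B n).1 := antitone_nat_of_succ_le fun n => by
    rw [hB]; exact hf1 _
  have hmeas : ∀ n, μ (B n).1 ≤ μ x0.1 * (2⁻¹) ^ n := by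
    intro n
    induction n with
    | zero => simp [B]
    | succ k ih =>
      rw [hB, pow_succ, ← mul_assoc]
      exact (hf2 _).trans (by rw [ENNReal.div_eq_inv_mul, mul_comm]; gcongr)
  have hx0 : μ x0.1 ≠ ⊤ := (hf3 _).ne
  have hnull : μ (⋂ n, (B n).1) = 0 := by
    have ht : Tendsto (fun n => μ x0.1 * (2⁻¹ : ℝ≥0∞) ^ n) atTop (nhds 0) := by
      have := ENNReal.Tendsto.const_mul (a := μ x0.1)
        (ENNReal.tendsto_pow_atTop_nhds_zero_of_lt_one (r := 2⁻¹) (by simp)) (Or.inr hx0)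
      simpa using this
    refine le_antisymm (ge_of_tendsto' ht fun n => ?_) zero_le
    exact (measure_mono (Set.iInter_subset _ n)).trans (hmeas n)
  refine ⟨fun n => (B n).1 \ ⋂ n, (B n).1, fun n => (B n).2.1.diff (.iInter fun n => (B n).2.1),
    fun m n hmn => Set.sdiff_subset_sdiff_left (hanti hmn), ?_, fun n => ⟨?_, ?_⟩⟩
  · ext t
    simp only [Set.mem_iInter, Set.mem_empty_iff_false, iff_false]
    intro h
    exact (h 0).2 (Set.mem_iInter.2 fun n => (h n).1)
  · exact Set.sdiff_subset.trans ((hanti (Nat.zero_le n)).trans (hf1 _))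
  · rw [measure_sdiff_null hnull]; exact (B n).2.2

lemma exists_sets [SigmaFinite μ] (hna : IsNonatomic μ) {F : T → ℝ≥0∞} (hF : AEMeasurable F μ)
    (hi : ∫⁻ t, F t ∂μ = ⊤) :
    ∃ A : ℕ → Set T, (∀ n, MeasurableSet (A n)) ∧ Antitone A ∧ (⋂ n, A n) = ∅ ∧
      ∀ n, ∫⁻ t in A n, F t ∂μ = ⊤ := by
  obtain ⟨G, hG, hFG⟩ := hF
  have key : ∃ A : ℕ → Set T, (∀ n, MeasurableSet (A n)) ∧ Antitone A ∧ (⋂ n, A n) = ∅ ∧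
      ∀ n, ∫⁻ t in A n, G t ∂μ = ⊤ := by
    rw [lintegral_congr_ae hFG] at hi
    have hZ : MeasurableSet {t | G t = ⊤} := hG (measurableSet_singleton _)
    rcases eq_or_ne (μ {t | G t = ⊤}) 0 with hz | hz
    · have hS := measurableSet_spanningSets μ
      have hle : ∀ n : ℕ, MeasurableSet {t | G t ≤ n} := fun n => measurableSet_le hG measurable_const
      refine ⟨fun n => (spanningSets μ n ∩ {t | G t ≤ n})ᶜ \ {t | G t = ⊤}, fun n =>
        (((hS n).inter (hle n)).compl).diff hZ, ?_, ?_, ?_⟩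
      · intro m n hmn
        refine Set.sdiff_subset_sdiff_left (Set.compl_subset_compl.2 ?_)
        refine Set.inter_subset_inter (monotone_spanningSets μ hmn) fun t ht => ?_
        have ht' : G t ≤ m := ht
        exact ht'.trans (by exact_mod_cast hmn)
      · ext t
        simp only [Set.mem_iInter, Set.mem_empty_iff_false, iff_false]
        intro h
        have hfin : G t ≠ ⊤ := (h 0).2
        obtain ⟨n1, hn1⟩ := ENNReal.exists_nat_gt hfin
        have : t ∈ ⋃ n, spanningSets μ n := by simp [iUnion_spanningSets]
        obtain ⟨n2, hn2⟩ := Set.mem_iUnion.1 this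
        refine (h (max n1 n2)).1 ⟨monotone_spanningSets μ (le_max_right _ _) hn2, ?_⟩
        exact hn1.le.trans (by exact_mod_cast le_max_left _ _)
      · intro n
        have hae := sdiff_null_ae_eq_self (s := (spanningSets μ n ∩ {t | G t ≤ n})ᶜ) hz
        rw [setLIntegral_congr hae]
        have hsum := lintegral_add_compl (μ := μ) G ((hS n).inter (hle n))
        rw [hi] at hsum
        have hfin : ∫⁻ t in spanningSets μ n ∩ {t | G t ≤ n}, G t ∂μ < ⊤ := by
          calc _ ≤ ∫⁻ t in spanningSets μ n ∩ {t | G t ≤ n}, (n : ℝ≥0∞) ∂μ :=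
                setLIntegral_mono measurable_const fun t ht => ht.2
            _ = n * μ (spanningSets μ n ∩ {t | G t ≤ n}) := by simp
            _ < ⊤ := ENNReal.mul_lt_top (by simp)
                ((measure_mono Set.inter_subset_left).trans_lt (measure_spanningSets_lt_top μ n))
        rcases ENNReal.add_eq_top.1 hsum with h | h
        · exact absurd h hfin.ne
        · exact h
    · obtain ⟨A, h1, h2, h3, h4⟩ := exists_vanishing hna hZ (pos_iff_ne_zero.2 hz)
      refine ⟨A, h1, h2, h3, fun n => ?_⟩
      rw [setLIntegral_congr_fun (g := fun _ => ⊤) (h1 n) (fun t ht => (h4 n).1 ht)]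
      simp [ENNReal.top_mul (h4 n).2.ne']
  obtain ⟨A, h1, h2, h3, h4⟩ := key
  refine ⟨A, h1, h2, h3, fun n => ?_⟩
  rw [← h4 n]
  exact lintegral_congr_ae (ae_restrict_of_ae hFG)

lemma main_aux [SigmaFinite μ] (hna : IsNonatomic μ) (P : MOFunction T μ)
    (u : T → ℝ) (hu : P.memLPhi u) (N : (T → ℝ) → ℝ) (hN0 : ∀ w, 0 ≤ N w)
    (hNup : ∀ (un : ℕ → T → ℝ) (l : ℝ), 0 < l → (∀ n, Measurable (un n)) →
      Tendsto (fun n => P.modular (fun t => un n t / l)) atTop (nhds 0) → ⨅ n, N (un n) ≤ l)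
    (hNlow : ∀ (w : T → ℝ) (l a : ℝ), Measurable w → (∀ t, 0 ≤ w t) → 0 < l →
      P.modular (fun t => w t / l) < ⊤ → 0 < a → P.modular (fun t => w t / a) = ⊤ → a ≤ N w) :
    P.thetaPhi u = sSup {r : ℝ | ∃ un : ℕ → T → ℝ,
        (∀ n, Measurable (un n)) ∧ (∀ n t, 0 ≤ un n t ∧ un n t ≤ |u t|) ∧
        (∀ n t, un (n + 1) t ≤ un n t) ∧
        (∀ t, Tendsto (fun n => un n t) atTop (nhds 0)) ∧
        r = ⨅ n, N (un n)} := by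
  obtain ⟨hum, l0, hl0, hml0⟩ := hu
  have hmem : 0 < l0⁻¹ ∧ P.modular (fun t => u t / l0⁻¹) < ⊤ := by
    refine ⟨by positivity, ?_⟩
    convert hml0 using 3 with t
    simp [mul_comm]
  have hth0 : 0 ≤ P.thetaPhi u := Real.sInf_nonneg fun _ h => h.1.le
  set S := {r : ℝ | ∃ un : ℕ → T → ℝ,
        (∀ n, Measurable (un n)) ∧ (∀ n t, 0 ≤ un n t ∧ un n t ≤ |u t|) ∧
        (∀ n t, un (n + 1) t ≤ un n t) ∧
        (∀ t, Tendsto (fun n => un n t) atTop (nhds 0)) ∧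
        r = ⨅ n, N (un n)} with hS
  have hup : ∀ r ∈ S, r ≤ P.thetaPhi u := by
    rintro r ⟨un, h1, h2, h3, h4, rfl⟩
    refine le_of_forall_gt_imp_ge_of_dense fun c hc => ?_
    obtain ⟨l, ⟨hl, hlm⟩, hlc⟩ := exists_lt_of_csInf_lt ⟨l0⁻¹, hmem⟩ hc
    exact (hNup un l hl h1 (P.modular_tendsto hum hl hlm h1 h2 h4)).trans hlc.le
  refine le_antisymm ?_ (Real.sSup_le hup hth0)
  refine le_of_forall_lt_imp_le_of_dense fun a ha => ?_
  rcases le_or_gt a 0 with ha0 | ha0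
  · refine ha0.trans (Real.sSup_nonneg ?_)
    rintro r ⟨un, h1, h2, h3, h4, rfl⟩
    exact Real.iInf_nonneg fun n => hN0 _
  have hi : P.modular (fun t => u t / a) = ⊤ := by
    by_contra h
    have : P.thetaPhi u ≤ a := csInf_le ⟨0, fun _ h => h.1.le⟩ ⟨ha0, lt_top_iff_ne_top.2 h⟩
    exact absurd ha this.not_gt
  obtain ⟨A, hA1, hA2, hA3, hA4⟩ := exists_sets hna
    (P.aemeas (w := fun t => ENNReal.ofReal |u t / a|) (by fun_prop)) hi
  have hw0 : ∀ n t, 0 ≤ (A n).indicator (fun t => |u t|) t := fun n t =>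
    Set.indicator_nonneg (fun _ _ => abs_nonneg _) t
  have hwle : ∀ n t, (A n).indicator (fun t => |u t|) t ≤ |u t| := fun n t =>
    Set.indicator_le_self' (fun _ _ => abs_nonneg _) t
  have hwm : ∀ n, Measurable ((A n).indicator (fun t => |u t|)) := fun n =>
    (by fun_prop : Measurable fun t => |u t|).indicator (hA1 n)
  refine le_csSup_of_le ⟨_, hup⟩ ⟨fun n => (A n).indicator (fun t => |u t|), hwm,
    fun n t => ⟨hw0 n t, hwle n t⟩, fun n t => ?_, fun t => ?_, rfl⟩ ?_
  · exact Set.indicator_le_indicator_of_subset (hA2 (Nat.le_succ n)) (fun _ => abs_nonneg _) t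
  · have : ∃ n, t ∉ A n := by
      by_contra! h
      have : t ∈ ⋂ n, A n := Set.mem_iInter.2 h
      simp [hA3] at this
    obtain ⟨n0, hn0⟩ := this
    refine tendsto_const_nhds.congr' ?_
    filter_upwards [eventually_ge_atTop n0] with n hn
    rw [Set.indicator_of_notMem]
    exact fun h => hn0 (hA2 hn h)
  · refine le_ciInf fun n => ?_
    refine hNlow _ _ a (hwm n) (hw0 n) hmem.1 ?_ ha0 ?_
    · refine lt_of_le_of_lt (P.modular_mono fun t => ?_) hmem.2
      rw [abs_div, abs_div, abs_of_nonneg (hw0 n t)]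
      gcongr
      exact hwle n t
    · rw [eq_top_iff, ← hA4 n, modular, ← lintegral_indicator (hA1 n)]
      refine lintegral_mono fun t => ?_
      by_cases h : t ∈ A n
      · simp [h, abs_div]
      · simp [h]

end MOFunction

/-- `θ_Φ(u) = Q_Φ(u) = Q_{Φ,0}(u)` for every `u ∈ L^Φ`. -/
theorem stmt7 [SigmaFinite μ] (hna : IsNonatomic μ) (P : MOFunction T μ)
    (u : T → ℝ) (hu : P.memLPhi u) :
    P.thetaPhi u = sSup {r : ℝ | ∃ un : ℕ → T → ℝ,
        (∀ n, Measurable (un n)) ∧ (∀ n t, 0 ≤ un n t ∧ un n t ≤ |u t|) ∧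
        (∀ n t, un (n + 1) t ≤ un n t) ∧
        (∀ t, Tendsto (fun n => un n t) atTop (nhds 0)) ∧
        r = ⨅ n, P.luxNorm (un n)} ∧
    P.thetaPhi u = sSup {r : ℝ | ∃ un : ℕ → T → ℝ,
        (∀ n, Measurable (un n)) ∧ (∀ n t, 0 ≤ un n t ∧ un n t ≤ |u t|) ∧
        (∀ n t, un (n + 1) t ≤ un n t) ∧
        (∀ t, Tendsto (fun n => un n t) atTop (nhds 0)) ∧
        r = ⨅ n, P.orliczNorm (un n)} := by
  refine ⟨main_aux hna P u hu P.luxNorm P.luxNorm_nonneg ?_ ?_,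
    main_aux hna P u hu P.orliczNorm P.orliczNorm_nonneg ?_ ?_⟩
  · intro un l hl hm ht
    obtain ⟨n, hn⟩ := (ht.eventually_le_const (u := 1) (by simp)).exists
    exact (ciInf_le ⟨0, by rintro _ ⟨n, rfl⟩; exact P.luxNorm_nonneg _⟩ n).trans
      (P.luxNorm_le hl hn)
  · intro w l a _ _ hl hm ha hi
    exact P.luxNorm_lower hl hm ha hi
  · intro un l hl hm ht
    have h1 : Tendsto (fun n => l * ((P.modular (fun t => un n t / l)).toReal + 1)) atTop
        (nhds l) := by
      have := (((ENNReal.tendsto_toReal (by simp)).comp ht).add_const 1).const_mul l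
      simpa using this
    refine ge_of_tendsto h1 ?_
    filter_upwards [ht.eventually_lt_const (u := ⊤) (by simp)] with n hn
    exact (ciInf_le ⟨0, by rintro _ ⟨n, rfl⟩; exact P.orliczNorm_nonneg _⟩ n).trans
      (P.orliczNorm_le (hm n) hl hn)
  · intro w l a hw hw0 hl hm ha hi
    exact P.orliczNorm_lower hw hw0 hl hm ha hi
end
end

section
/- Let u ∈ L_0^Φ \ {0} with K(u) = ∅. Then u is a smooth point if and only if either (i) I_{Φ*}(b_{Φ*} χ_{supp u}) = 1 and a_{Φ*} χ_{T∖supp u} = 0, or (ii) I_{Φ*}(b_{Φ*}) < 1 and μ(T ∖ supp u) = 0, where a_{Φ*}(t) = sup{v≥0 : Φ*(t,v)=0} and b_{Φ*}(t) = sup{v≥0 : Φ*(t,v)<∞}. -/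
open MeasureTheory ENNReal NNReal Filter Topology

noncomputable section

open MOFunction

variable {T : Type*} [MeasurableSpace T] {μ : Measure T}

structure GoodFn (φ : ℝ≥0∞ → ℝ≥0∞) : Prop where
  cvx : ∀ a b : ℝ≥0∞, ∀ p : ℝ≥0, p ≤ 1 →
    φ (p • a + (1 - p) • b) ≤ p • φ a + (1 - p) • φ b
  lsc : LowerSemicontinuous φ
  zero : φ 0 = 0
  lim : Tendsto φ (nhdsWithin 0 (Set.Ioi 0)) (nhds 0)
  top : φ ⊤ = ⊤

def cj (φ : ℝ≥0∞ → ℝ≥0∞) (v : ℝ≥0∞) : ℝ≥0∞ := ⨆ u ∈ Set.Ioi (0 : ℝ≥0∞), u * v - φ u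

def bj (φ : ℝ≥0∞ → ℝ≥0∞) : ℝ≥0∞ := sSup {v : ℝ≥0∞ | cj φ v < ⊤}

def aj (φ : ℝ≥0∞ → ℝ≥0∞) : ℝ≥0∞ := sSup {v : ℝ≥0∞ | cj φ v = 0}

lemma cj_mono (φ : ℝ≥0∞ → ℝ≥0∞) : Monotone (cj φ) := by
  intro x y h
  unfold cj
  gcongr

lemma cj_zero (φ : ℝ≥0∞ → ℝ≥0∞) : cj φ 0 = 0 := by simp [cj]

lemma cj_scale (φ : ℝ≥0∞ → ℝ≥0∞) {p : ℝ≥0∞} (hp : p ≤ 1) (v : ℝ≥0∞) :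
    cj φ (p * v) ≤ p * cj φ v := by
  unfold cj
  refine iSup₂_le fun u hu => ?_
  have h1 : u * v - φ u ≤ ⨆ u ∈ Set.Ioi (0 : ℝ≥0∞), u * v - φ u :=
    le_iSup₂_of_le u hu le_rfl
  refine le_trans ?_ (mul_le_mul_right h1 p)
  rw [ENNReal.mul_sub (fun _ _ => (hp.trans_lt one_lt_top).ne)]
  have h2 : p * φ u ≤ φ u := mul_le_of_le_one_left zero_le hp
  calc u * (p * v) - φ u = p * (u * v) - φ u := by ring_nf
    _ ≤ _ := by gcongr

lemma le_bj {φ : ℝ≥0∞ → ℝ≥0∞} {v : ℝ≥0∞} (h : cj φ v < ⊤) : v ≤ bj φ := le_sSup h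

lemma cj_lt_top_of_lt {φ : ℝ≥0∞ → ℝ≥0∞} {v : ℝ≥0∞} (h : v < bj φ) : cj φ v < ⊤ := by
  obtain ⟨w, hw, hvw⟩ := lt_sSup_iff.1 h
  exact (cj_mono φ hvw.le).trans_lt hw

namespace GoodFn

variable {φ : ℝ≥0∞ → ℝ≥0∞} (G : GoodFn φ)
include G

lemma scale {p : ℝ≥0} (hp : p ≤ 1) (x : ℝ≥0∞) : φ (p * x) ≤ p * φ x := by
  have := G.cvx x 0 p hp
  simpa [ENNReal.smul_def, G.zero] using this

lemma mono : Monotone φ := by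
  intro x y h
  rcases eq_or_ne y ⊤ with rfl | hy
  · simp [G.top]
  lift y to ℝ≥0 using hy
  lift x to ℝ≥0 using ne_top_of_le_ne_top coe_ne_top h
  rcases eq_or_ne y 0 with rfl | hy0
  · simp at h; simp [h]
  have h' : x ≤ y := by exact_mod_cast h
  have hp : x / y ≤ 1 := div_le_one_of_le₀ h' zero_le
  have := G.scale hp y
  have e : ((x / y : ℝ≥0) : ℝ≥0∞) * y = x := by
    rw [← ENNReal.coe_mul, div_mul_cancel₀ _ hy0]
  rw [e] at this
  refine this.trans (mul_le_of_le_one_left zero_le (by exact_mod_cast hp))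

lemma young (x y : ℝ≥0∞) : x * y ≤ φ x + cj φ y := by
  rcases eq_or_ne x 0 with rfl | hx
  · simp
  rw [← tsub_le_iff_left]
  exact le_iSup₂_of_le (f := fun u (_ : u ∈ Set.Ioi (0 : ℝ≥0∞)) => u * y - φ u) x
    (pos_iff_ne_zero.2 hx) le_rfl

lemma cj_le {y C : ℝ≥0∞} (h : ∀ x : ℝ≥0, 0 < x → x * y ≤ φ x + C) : cj φ y ≤ C := by
  refine iSup₂_le fun u hu => ?_
  rcases eq_or_ne u ⊤ with rfl | hu'
  · simp [G.top]
  lift u to ℝ≥0 using hu'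
  rw [tsub_le_iff_left]
  exact h u (by exact_mod_cast (Set.mem_Ioi.1 hu))

lemma left_sup (x : ℝ≥0∞) :
    φ x = ⨆ q : ℚ, if (Real.toNNReal q : ℝ≥0∞) < x then φ (Real.toNNReal q) else 0 := by
  apply le_antisymm
  · refine le_of_forall_lt fun c hc => ?_
    have hx : 0 < x := by
      rw [pos_iff_ne_zero]; rintro rfl; simp [G.zero] at hc
    obtain ⟨l, hl, hl2⟩ := exists_Ioc_subset_of_mem_nhds (G.lsc x c hc) ⟨0, hx⟩
    obtain ⟨q, -, h1, h2⟩ := ENNReal.lt_iff_exists_rat_btwn.1 hl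
    refine lt_iSup_iff.2 ⟨q, ?_⟩
    rw [if_pos h2]
    exact hl2 ⟨h1, h2.le⟩
  · refine iSup_le fun q => ?_
    split_ifs with h
    · exact G.mono h.le
    · exact zero_le

lemma cj_sup (y : ℝ≥0∞) :
    cj φ y = ⨆ q : ℚ, (Real.toNNReal q : ℝ≥0∞) * y - φ (Real.toNNReal q) := by
  apply le_antisymm
  · refine G.cj_le fun x hx => ?_
    refine le_of_forall_lt fun c hc => ?_
    have hy : 0 < y := by
      rw [pos_iff_ne_zero]; rintro rfl; simp at hc
    have : ∃ z : ℝ≥0∞, z < x ∧ c < z * y := by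
      rcases eq_or_ne y ⊤ with rfl | hyt
      · have hx' : (0:ℝ≥0∞) < x := by exact_mod_cast hx
        obtain ⟨z, hz, hz2⟩ := exists_between hx'
        refine ⟨z, hz2, ?_⟩
        rw [ENNReal.mul_top hz.ne']
        exact hc.trans_le le_top
      · obtain ⟨z, h1, h2⟩ := exists_between
          ((ENNReal.div_lt_iff (Or.inl hy.ne') (Or.inl hyt)).2 hc)
        exact ⟨z, h2, (ENNReal.div_lt_iff (Or.inl hy.ne') (Or.inl hyt)).1 h1⟩
    obtain ⟨z, hz, hcz⟩ := this
    obtain ⟨q, -, h1, h2⟩ := ENNReal.lt_iff_exists_rat_btwn.1 hz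
    calc c < z * y := hcz
      _ ≤ (Real.toNNReal q : ℝ≥0∞) * y := by gcongr
      _ ≤ φ (Real.toNNReal q) + ((Real.toNNReal q : ℝ≥0∞) * y - φ (Real.toNNReal q)) :=
        le_add_tsub
      _ ≤ _ := add_le_add (G.mono h2.le) (le_iSup (fun q : ℚ => (Real.toNNReal q : ℝ≥0∞) * y - φ (Real.toNNReal q)) q)
  · refine iSup_le fun q => ?_
    rw [tsub_le_iff_left]
    exact G.young _ _

lemma slope {x y : ℝ≥0} (h : x ≤ y) : φ y ≤ φ x + (y - x : ℝ≥0) * bj φ := by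
  rcases h.eq_or_lt with rfl | h
  · simp
  by_contra! hc
  have hyx : ((y - x : ℝ≥0) : ℝ≥0∞) ≠ 0 := by
    exact_mod_cast (tsub_pos_of_lt h).ne'
  have hb : bj φ ≠ ⊤ := by
    intro hb; rw [hb, ENNReal.mul_top hyx] at hc; simp at hc
  have : ∃ v : ℝ≥0, bj φ < v ∧ φ x + (y - x : ℝ≥0) * v < φ y := by
    have hcont : Tendsto (fun v : ℝ≥0∞ => φ x + (y - x : ℝ≥0) * v) (𝓝[>] (bj φ))
        (𝓝 (φ x + (y - x : ℝ≥0) * bj φ)) := by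
      refine Tendsto.mono_left ?_ nhdsWithin_le_nhds
      exact tendsto_const_nhds.add (ENNReal.Tendsto.const_mul tendsto_id (Or.inr coe_ne_top))
    have : (𝓝[>] (bj φ)).NeBot := nhdsGT_neBot_of_exists_gt ⟨⊤, hb.lt_top⟩
    obtain ⟨v, hv, hv1⟩ := ((hcont.eventually (gt_mem_nhds hc)).and self_mem_nhdsWithin).exists
    have hvt : v ≠ ⊤ := by
      rintro rfl; rw [ENNReal.mul_top hyx] at hv; simp at hv
    lift v to ℝ≥0 using hvt
    exact ⟨v, hv1, hv⟩
  obtain ⟨v, hv, hvφ⟩ := this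
  have : cj φ v ≤ (y * v : ℝ≥0) := by
    refine G.cj_le fun z hz => ?_
    rcases le_or_gt z y with hzy | hzy
    · calc (z:ℝ≥0∞) * v ≤ (y * v : ℝ≥0) := by push_cast; gcongr
        _ ≤ _ := le_add_self
    · have key : φ x + (z - x : ℝ≥0) * v ≤ φ z := by
        by_contra! hlt
        apply hvφ.not_ge
        have hzx : z - x ≠ 0 := (tsub_pos_of_lt (h.trans hzy)).ne'
        set p : ℝ≥0 := (y - x) / (z - x) with hpdef
        have hp : p ≤ 1 := div_le_one_of_le₀ (by gcongr) zero_le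
        have hpz : p * (z - x) = y - x := div_mul_cancel₀ _ hzx
        have e : (p : ℝ≥0∞) * z + (1 - p : ℝ≥0) * x = y := by
          norm_cast
          apply NNReal.coe_injective
          have := congrArg NNReal.toReal hpz
          push_cast [NNReal.coe_sub hp, NNReal.coe_sub h.le, NNReal.coe_sub (h.trans hzy).le] at this ⊢
          linarith
        have hpp : (p : ℝ≥0∞) + (1 - p : ℝ≥0) = 1 := by
          norm_cast; exact add_tsub_cancel_of_le hp
        have := G.cvx z x p hp
        simp only [ENNReal.smul_def, smul_eq_mul] at this
        rw [e] at this
        refine this.trans ?_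
        calc (p : ℝ≥0∞) * φ z + (1 - p : ℝ≥0) * φ x
            ≤ p * (φ x + (z - x : ℝ≥0) * v) + (1 - p : ℝ≥0) * φ x := by gcongr
          _ = (p + (1 - p : ℝ≥0)) * φ x + (p * (z - x) : ℝ≥0) * v := by push_cast; ring
          _ = _ := by rw [hpp, hpz, one_mul]
      have e2 : (z : ℝ≥0∞) = x + (z - x : ℝ≥0) := by
        norm_cast; exact (add_tsub_cancel_of_le (h.trans hzy).le).symm
      calc (z : ℝ≥0∞) * v = x * v + (z - x : ℝ≥0) * v := by
            rw [← add_mul, ← e2]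
        _ ≤ y * v + φ z := add_le_add (by gcongr) (le_trans le_add_self key)
        _ = _ := by push_cast; ring
  exact hv.not_ge (le_bj (this.trans_lt coe_lt_top))

lemma le_mul_bj (x : ℝ≥0) : φ x ≤ x * bj φ := by
  simpa [G.zero] using G.slope (zero_le (a := x))

lemma iSup_eq (x : ℝ≥0) (hx : 0 < x) :
    ⨆ n : ℕ, φ ((n + 1 : ℝ≥0) * x : ℝ≥0) / ((n + 1 : ℝ≥0)) = x * bj φ := by
  apply le_antisymm
  · refine iSup_le fun n => ?_
    refine ENNReal.div_le_of_le_mul ?_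
    refine (G.le_mul_bj _).trans (le_of_eq ?_)
    push_cast; ring
  · refine le_of_forall_lt fun d hd => ?_
    have hx0 : (x : ℝ≥0∞) ≠ 0 := by exact_mod_cast hx.ne'
    rw [mul_comm] at hd
    obtain ⟨v, h1, h2⟩ := exists_between
      ((ENNReal.div_lt_iff (Or.inl hx0) (Or.inl coe_ne_top)).2 hd)
    refine ((ENNReal.div_lt_iff (Or.inl hx0) (Or.inl coe_ne_top)).1 h1).trans_le ?_
    have hC := (cj_lt_top_of_lt h2).ne
    set S := ⨆ n : ℕ, φ ((n + 1 : ℝ≥0) * x : ℝ≥0) / ((n + 1 : ℝ≥0)) with hS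
    have hlim : Tendsto (fun n : ℕ => S + cj φ v * ((n + 1 : ℕ) : ℝ≥0∞)⁻¹) atTop
        (𝓝 (S + cj φ v * 0)) := by
      refine tendsto_const_nhds.add (ENNReal.Tendsto.const_mul ?_ (Or.inr hC))
      exact (tendsto_add_atTop_iff_nat (f := fun n : ℕ => (n : ℝ≥0∞)⁻¹) 1).2
        ENNReal.tendsto_inv_nat_nhds_zero
    rw [mul_zero, add_zero] at hlim
    refine ge_of_tendsto' hlim fun n => ?_
    have hn0 : ((n + 1 : ℝ≥0) : ℝ≥0∞) ≠ 0 := by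
      exact_mod_cast (Nat.succ_ne_zero n)
    have := G.young ((n + 1 : ℝ≥0) * x : ℝ≥0) v
    have h3 : φ ((n + 1 : ℝ≥0) * x : ℝ≥0) / ((n + 1 : ℝ≥0)) ≤ S :=
      le_iSup (fun n : ℕ => φ ((n + 1 : ℝ≥0) * x : ℝ≥0) / ((n + 1 : ℝ≥0))) n
    calc v * x = (((n + 1 : ℝ≥0) * x : ℝ≥0) * v) / (n + 1 : ℝ≥0) := by
          rw [ENNReal.coe_mul, mul_assoc, mul_div_assoc,
            ENNReal.mul_div_cancel hn0 coe_ne_top, mul_comm]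
      _ ≤ (φ ((n + 1 : ℝ≥0) * x : ℝ≥0) + cj φ v) / (n + 1 : ℝ≥0) := by gcongr
      _ ≤ _ := by
        rw [ENNReal.add_div]
        refine add_le_add h3 ?_
        rw [div_eq_mul_inv]
        push_cast
        exact le_rfl

lemma mono_slope {p : ℝ≥0} (hp : 1 ≤ p) (x : ℝ≥0∞) : p * φ x ≤ φ (p * x) := by
  have hp0 : p ≠ 0 := (zero_lt_one.trans_le hp).ne'
  have := G.scale (p := p⁻¹) (inv_le_one_of_one_le₀ hp) (p * x)
  rw [← mul_assoc, ← ENNReal.coe_mul, inv_mul_cancel₀ hp0, ENNReal.coe_one, one_mul] at this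
  calc p * φ x ≤ p * ((p⁻¹ : ℝ≥0) * φ (p * x)) := by gcongr
    _ = _ := by rw [← mul_assoc, ← ENNReal.coe_mul, mul_inv_cancel₀ hp0, ENNReal.coe_one, one_mul]

lemma exists_fin : ∃ x : ℝ≥0, 0 < x ∧ φ x ≤ 1 := by
  have h := G.lim.eventually (gt_mem_nhds (zero_lt_one))
  have h2 : ∀ᶠ x : ℝ≥0∞ in 𝓝[>] 0, x < 1 :=
    nhdsWithin_le_nhds (gt_mem_nhds zero_lt_one)
  obtain ⟨x, ⟨h1, h2⟩, h3⟩ := ((h.and h2).and self_mem_nhdsWithin).exists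
  lift x to ℝ≥0 using (h2.trans one_lt_top).ne
  exact ⟨x, by exact_mod_cast h3, h1.le⟩

lemma cj_top : cj φ ⊤ = ⊤ := by
  obtain ⟨x, hx, h⟩ := G.exists_fin
  have := G.young x ⊤
  rw [ENNReal.mul_top (by exact_mod_cast hx.ne')] at this
  have h2 := top_le_iff.1 this
  rw [ENNReal.add_eq_top] at h2
  rcases h2 with h2 | h2
  · rw [h2] at h; simp at h
  · exact h2

lemma exists_cj : ∃ v : ℝ≥0, 0 < v ∧ cj φ v ≤ 1 := by
  have h := G.lsc ⊤ 1 (by simp [G.top])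
  obtain ⟨l, hl, hl2⟩ := exists_Ioc_subset_of_mem_nhds h ⟨0, by simp⟩
  obtain ⟨x, hx, hx2⟩ := exists_between hl
  lift x to ℝ≥0 using hx2.ne
  have h1 : 1 < φ x := hl2 ⟨hx, le_top⟩
  have hx0 : x ≠ 0 := by rintro rfl; simp [G.zero] at h1
  have hx0' : 0 < x := pos_iff_ne_zero.2 hx0
  refine ⟨x⁻¹, by positivity, G.cj_le fun z hz => ?_⟩
  rcases le_or_gt z x with h | h
  · refine le_trans ?_ le_add_self
    norm_cast
    rw [← div_eq_mul_inv]
    exact div_le_one_of_le₀ h zero_le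
  · refine le_trans ?_ le_self_add
    have := G.mono_slope (p := z * x⁻¹) (by rw [← div_eq_mul_inv, one_le_div₀ hx0']; exact h.le) x
    rw [← ENNReal.coe_mul (z * x⁻¹), mul_assoc, inv_mul_cancel₀ hx0, mul_one] at this
    refine le_trans ?_ this
    rw [← ENNReal.coe_mul]
    exact le_mul_of_one_le_right zero_le h1.le

lemma bj_pos : 0 < bj φ := by
  obtain ⟨v, hv, h⟩ := G.exists_cj
  exact lt_of_lt_of_le (by exact_mod_cast hv) (le_bj (h.trans_lt one_lt_top))

lemma tail (hc : cj φ (bj φ) ≠ ⊤) {ε : ℝ≥0∞} (hε : 0 < ε) :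
    ∃ x₀ : ℝ≥0, ∀ x : ℝ≥0, x₀ ≤ x → cj φ (bj φ) + φ x ≤ x * bj φ + ε := by
  have : ∃ x₀ : ℝ≥0, cj φ (bj φ) + φ x₀ ≤ x₀ * bj φ + ε := by
    by_contra! hcon
    rcases eq_or_ne (cj φ (bj φ)) 0 with h0 | h0
    · have := hcon 0
      simp [h0, G.zero] at this
    have : cj φ (bj φ) ≤ cj φ (bj φ) - ε := by
      refine G.cj_le fun x hx => ?_
      have hx' := (hcon x).le
      have h2 : (x * bj φ + ε) - ε ≤ φ x + cj φ (bj φ) - ε := by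
        rw [add_comm (φ x)]; gcongr
      rcases eq_or_ne ε ⊤ with rfl | hεt
      · have := hcon x
        simp at this
      rw [ENNReal.add_sub_cancel_right hεt] at h2
      exact h2.trans add_tsub_le_assoc
    exact (ENNReal.sub_lt_self hc h0 hε.ne').not_ge this
  obtain ⟨x₀, h⟩ := this
  refine ⟨x₀, fun x hx => ?_⟩
  calc cj φ (bj φ) + φ x ≤ cj φ (bj φ) + (φ x₀ + (x - x₀ : ℝ≥0) * bj φ) := by
        gcongr; exact G.slope hx
    _ ≤ (x₀ * bj φ + ε) + (x - x₀ : ℝ≥0) * bj φ := by rw [← add_assoc]; gcongr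
    _ = ((x₀ + (x - x₀) : ℝ≥0) : ℝ≥0∞) * bj φ + ε := by push_cast; ring
    _ = _ := by rw [add_tsub_cancel_of_le hx]

lemma aj_zero (ha : aj φ = 0) {ε : ℝ≥0} (hε : 0 < ε) :
    ∃ h : ℝ≥0, 0 < h ∧ ∀ x : ℝ≥0, x ≤ h → φ x ≤ x * ε := by
  have : ∃ h : ℝ≥0, 0 < h ∧ φ h ≤ h * ε := by
    by_contra! hcon
    have h0 : cj φ ε = 0 := by
      refine le_antisymm (G.cj_le fun x hx => ?_) zero_le
      simpa using (hcon x hx).le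
    have : (ε : ℝ≥0∞) ≤ aj φ := le_sSup h0
    rw [ha] at this
    simp at this
    exact hε.ne' this
  obtain ⟨h, hh, hφ⟩ := this
  refine ⟨h, hh, fun x hx => ?_⟩
  have := G.scale (p := x / h) (div_le_one_of_le₀ hx zero_le) h
  have e : ((x / h : ℝ≥0) : ℝ≥0∞) * h = x := by
    rw [← ENNReal.coe_mul, div_mul_cancel₀ _ hh.ne']
  rw [e] at this
  calc φ x ≤ _ := this
    _ ≤ ((x / h : ℝ≥0) : ℝ≥0∞) * (h * ε) := by gcongr
    _ = _ := by rw [← mul_assoc, e]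

end GoodFn

namespace MOFunction

lemma ae_good (P : MOFunction T μ) : ∀ᵐ t ∂μ, GoodFn (P.toFun t) := by
  filter_upwards [P.convex', P.lsc', P.zero', P.limZero', P.top'] with t h1 h2 h3 h4 h5
  exact ⟨h1, h2, h3, h4, h5⟩

lemma conj_eq (P : MOFunction T μ) (t : T) (v : ℝ≥0∞) : P.conj t v = cj (P.toFun t) v := rfl

lemma bConj_eq (P : MOFunction T μ) (t : T) : P.bConj t = bj (P.toFun t) := rfl

lemma aConj_eq (P : MOFunction T μ) (t : T) : P.aConj t = aj (P.toFun t) := rfl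

lemma aem_toFun (P : MOFunction T μ) {x : T → ℝ≥0∞} (hx : AEMeasurable x μ) :
    AEMeasurable (fun t => P.toFun t (x t)) μ := by
  have h1 : AEMeasurable (fun t => ⨆ q : ℚ, if (Real.toNNReal q : ℝ≥0∞) < hx.mk x t then
      P.toFun t (Real.toNNReal q) else 0) μ := by
    refine Measurable.aemeasurable (Measurable.iSup fun q => ?_)
    exact Measurable.ite (measurableSet_lt measurable_const hx.measurable_mk)
      (P.measurable' _) measurable_const
  refine h1.congr ?_
  filter_upwards [P.ae_good, hx.ae_eq_mk] with t G e
  rw [e, G.left_sup]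

lemma aem_conj (P : MOFunction T μ) {x : T → ℝ≥0∞} (hx : AEMeasurable x μ) :
    AEMeasurable (fun t => P.conj t (x t)) μ := by
  have h1 : AEMeasurable (fun t => ⨆ q : ℚ, (Real.toNNReal q : ℝ≥0∞) * x t -
      P.toFun t (Real.toNNReal q)) μ := by
    refine AEMeasurable.iSup fun q => ?_
    exact (hx.const_mul _).sub (P.measurable' _).aemeasurable
  refine h1.congr ?_
  filter_upwards [P.ae_good] with t G
  rw [conj_eq, G.cj_sup]

lemma aem_b (P : MOFunction T μ) : AEMeasurable P.bConj μ := by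
  have h1 : AEMeasurable (fun t => ⨆ n : ℕ, P.toFun t ((n + 1 : ℝ≥0) * 1 : ℝ≥0) /
      ((n + 1 : ℝ≥0))) μ := by
    refine AEMeasurable.iSup fun q => ?_
    exact (P.measurable' _).aemeasurable.div_const _
  refine h1.congr ?_
  filter_upwards [P.ae_good] with t G
  rw [bConj_eq, G.iSup_eq 1 one_pos]
  simp

lemma aem_abs {x : T → ℝ} (hx : Measurable x) :
    AEMeasurable (fun t => ENNReal.ofReal |x t|) μ := by fun_prop

/-- Young's inequality, integrated. -/
lemma young_int (P : MOFunction T μ) {x v : T → ℝ} (hx : Measurable x) {k : ℝ} (hk : 0 < k) :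
    ENNReal.ofReal k * ∫⁻ t, ENNReal.ofReal |x t| * ENNReal.ofReal |v t| ∂μ ≤
      P.modular (fun t => k * x t) + P.modularConj v := by
  rw [← lintegral_const_mul' _ _ ofReal_ne_top]
  unfold modular modularConj
  rw [← lintegral_add_left' (P.aem_toFun (aem_abs (hx.const_mul k)))]
  refine lintegral_mono_ae ?_
  filter_upwards [P.ae_good] with t G
  refine le_trans (le_of_eq ?_) (G.young _ _)
  rw [abs_mul, abs_of_pos hk, ENNReal.ofReal_mul hk.le, mul_assoc]

lemma lint_lt_top (P : MOFunction T μ) {x v : T → ℝ} (hx : P.memLPhi x)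
    (hv1 : P.modularConj v ≤ 1) :
    ∫⁻ t, ENNReal.ofReal |x t| * ENNReal.ofReal |v t| ∂μ < ⊤ := by
  obtain ⟨hxm, l, hl, hl2⟩ := hx
  have h1 := P.young_int (v := v) hxm hl
  have h2 : ENNReal.ofReal l * ∫⁻ t, ENNReal.ofReal |x t| * ENNReal.ofReal |v t| ∂μ < ⊤ :=
    h1.trans_lt (ENNReal.add_lt_top.2 ⟨hl2, hv1.trans_lt one_lt_top⟩)
  by_contra! h
  rw [top_le_iff.1 h, ENNReal.mul_top (by simpa using hl)] at h2
  simp at h2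

lemma integrable_mul (P : MOFunction T μ) {x v : T → ℝ} (hx : P.memLPhi x)
    (hv : Measurable v) (hv1 : P.modularConj v ≤ 1) : Integrable (fun t => x t * v t) μ := by
  refine ⟨(hx.1.mul hv).aestronglyMeasurable, ?_⟩
  rw [hasFiniteIntegral_iff_norm]
  refine lt_of_le_of_lt (le_of_eq ?_) (P.lint_lt_top hx hv1)
  congr 1; ext t
  rw [Real.norm_eq_abs, abs_mul, ENNReal.ofReal_mul (abs_nonneg _)]

lemma abs_int_le {x v : T → ℝ} {C : ℝ} (hC : 0 ≤ C)
    (h : ∫⁻ t, ENNReal.ofReal |x t| * ENNReal.ofReal |v t| ∂μ ≤ ENNReal.ofReal C) :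
    |∫ t, x t * v t ∂μ| ≤ C := by
  have h1 := norm_integral_le_lintegral_norm (μ := μ) (fun t => x t * v t)
  rw [Real.norm_eq_abs] at h1
  refine h1.trans (ENNReal.toReal_le_of_le_ofReal hC ?_)
  refine le_trans (le_of_eq ?_) h
  congr 1; ext t
  rw [Real.norm_eq_abs, abs_mul, ENNReal.ofReal_mul (abs_nonneg _)]

lemma orlicz_nonneg (P : MOFunction T μ) (x : T → ℝ) : 0 ≤ P.orliczNorm x := by
  refine Real.sSup_nonneg ?_
  rintro r ⟨v, -, -, rfl⟩
  exact abs_nonneg _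

lemma orlicz_le (P : MOFunction T μ) {x : T → ℝ} {C : ℝ} (hC : 0 ≤ C)
    (h : ∀ v, Measurable v → P.modularConj v ≤ 1 → |∫ t, x t * v t ∂μ| ≤ C) :
    P.orliczNorm x ≤ C := by
  refine Real.sSup_le ?_ hC
  rintro r ⟨v, h1, h2, rfl⟩
  exact h v h1 h2

lemma le_orlicz (P : MOFunction T μ) {x v : T → ℝ} (hx : P.memLPhi x) (hv : Measurable v)
    (hv1 : P.modularConj v ≤ 1) : |∫ t, x t * v t ∂μ| ≤ P.orliczNorm x := by
  refine le_csSup ?_ ⟨v, hv, hv1, rfl⟩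
  obtain ⟨hxm, l, hl, hl2⟩ := hx
  refine ⟨((ENNReal.ofReal l)⁻¹ * (P.modular (fun t => l * x t) + 1)).toReal, ?_⟩
  rintro r ⟨w, h1, h2, rfl⟩
  have hl0 : ENNReal.ofReal l ≠ 0 := by simpa using hl
  refine abs_int_le ENNReal.toReal_nonneg ?_
  rw [ENNReal.ofReal_toReal]
  · have h3 := P.young_int (v := w) hxm hl
    calc _ = (ENNReal.ofReal l)⁻¹ * (ENNReal.ofReal l *
          ∫⁻ t, ENNReal.ofReal |x t| * ENNReal.ofReal |w t| ∂μ) := by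
          rw [← mul_assoc, ENNReal.inv_mul_cancel hl0 ofReal_ne_top, one_mul]
      _ ≤ _ := by gcongr; exact h3.trans (by gcongr)
  · exact ENNReal.mul_ne_top (ENNReal.inv_ne_top.2 hl0) (ENNReal.add_lt_top.2 ⟨hl2, one_lt_top⟩).ne

lemma mem_smul (P : MOFunction T μ) {x : T → ℝ} (hx : P.memLPhi x) {c : ℝ} (hc : 0 < c) :
    P.memLPhi (c • x) := by
  obtain ⟨hxm, l, hl, hl2⟩ := hx
  refine ⟨hxm.const_smul c, l / c, by positivity, ?_⟩
  convert hl2 using 3 with t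
  simp [← mul_assoc, div_mul_cancel₀ _ hc.ne']

lemma mem_neg (P : MOFunction T μ) {x : T → ℝ} (hx : P.memLPhi x) :
    P.memLPhi (-x) := by
  obtain ⟨hxm, l, hl, hl2⟩ := hx
  refine ⟨hxm.neg, l, by positivity, ?_⟩
  simpa [modular] using hl2

lemma mem_add (P : MOFunction T μ) {x y : T → ℝ} (hx : P.memLPhi x) (hy : P.memLPhi y) :
    P.memLPhi (x + y) := by
  obtain ⟨hxm, l, hl, hl2⟩ := hx
  obtain ⟨hym, m, hm, hm2⟩ := hy
  refine ⟨hxm.add hym, min l m / 2, by positivity, ?_⟩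
  refine lt_of_le_of_lt ?_ (ENNReal.add_lt_top.2 ⟨hl2, hm2⟩)
  unfold modular
  rw [← lintegral_add_left' (P.aem_toFun (aem_abs (hxm.const_mul l)))]
  refine lintegral_mono_ae ?_
  filter_upwards [P.ae_good] with t G
  have h1 : |min l m / 2 * (x + y) t| ≤ max |l * x t| |m * y t| := by
    have hp : 0 < min l m := by positivity
    rw [abs_mul, abs_mul, abs_mul, abs_of_pos hl, abs_of_pos hm, abs_of_pos (by positivity)]
    have h2 : |(x + y) t| ≤ |x t| + |y t| := abs_add_le _ _
    have h3 : min l m * |x t| ≤ max (l * |x t|) (m * |y t|) :=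
      le_trans (by gcongr; exact min_le_left _ _) (le_max_left _ _)
    have h4 : min l m * |y t| ≤ max (l * |x t|) (m * |y t|) :=
      le_trans (by gcongr; exact min_le_right _ _) (le_max_right _ _)
    nlinarith
  refine (G.mono (ENNReal.ofReal_le_ofReal h1)).trans ?_
  rcases le_total |l * x t| |m * y t| with h | h
  · rw [max_eq_right h]; exact le_add_self
  · rw [max_eq_left h]; exact le_self_add

lemma orlicz_smul_le (P : MOFunction T μ) {x : T → ℝ} (hx : P.memLPhi x) {c : ℝ} (hc : 0 < c) :
    P.orliczNorm (c • x) ≤ c * P.orliczNorm x := by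
  refine P.orlicz_le (mul_nonneg hc.le (P.orlicz_nonneg x)) fun v hv hv1 => ?_
  have := P.le_orlicz hx hv hv1
  calc |∫ t, (c • x) t * v t ∂μ| = |c * ∫ t, x t * v t ∂μ| := by
        rw [← integral_const_mul]; congr 2; ext t; simp [mul_assoc]
    _ = c * |∫ t, x t * v t ∂μ| := by rw [abs_mul, abs_of_pos hc]
    _ ≤ _ := by gcongr

lemma support_le (P : MOFunction T μ) {f : (T → ℝ) →ₗ[ℝ] ℝ} (hf : P.dualNormOrlicz f = 1)
    {x : T → ℝ} (hx : P.memLPhi x) : f x ≤ P.orliczNorm x := by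
  have hbdd : BddAbove {r : ℝ | ∃ u : T → ℝ, P.memLPhi u ∧ P.orliczNorm u ≤ 1 ∧ r = |f u|} := by
    by_contra h
    have := Real.sSup_of_not_bddAbove h
    unfold dualNormOrlicz at hf
    rw [this] at hf
    exact zero_ne_one hf
  refine le_of_forall_gt_imp_ge_of_dense fun q hq => ?_
  have hq0 : 0 < q := (P.orlicz_nonneg x).trans_lt hq
  have h1 : |f (q⁻¹ • x)| ≤ 1 := by
    rw [← hf]
    refine le_csSup hbdd ⟨_, P.mem_smul hx (inv_pos.2 hq0), ?_, rfl⟩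
    refine (P.orlicz_smul_le hx (inv_pos.2 hq0)).trans ?_
    rw [inv_mul_le_iff₀ hq0, mul_one]; exact hq.le
  rw [map_smul, smul_eq_mul, abs_mul, abs_of_pos (inv_pos.2 hq0), inv_mul_le_iff₀ hq0,
    mul_one] at h1
  exact (le_abs_self _).trans h1

/-- Integral functionals which attain the norm at `u` give support functionals. -/
lemma exists_support (P : MOFunction T μ) {u v : T → ℝ} (hu : P.memLPhi u) (hv : Measurable v)
    (hv1 : P.modularConj v ≤ 1) (h : ∫ t, u t * v t ∂μ = P.orliczNorm u)
    (hpos : 0 < P.orliczNorm u) :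
    ∃ f : (T → ℝ) →ₗ[ℝ] ℝ, P.IsSupportAt f u ∧ ∀ w, P.memLPhi w → f w = ∫ t, w t * v t ∂μ := by
  let V : Submodule ℝ (T → ℝ) :=
    { carrier := {x | Integrable (fun t => x t * v t) μ}
      add_mem' := by
        intro a b ha hb
        have := Integrable.add ha hb
        refine this.congr (Eventually.of_forall fun t => ?_)
        simp [add_mul]
      zero_mem' := by simp
      smul_mem' := by
        intro c a ha
        refine (Integrable.const_mul ha c).congr (Eventually.of_forall fun t => ?_)
        simp [mul_assoc] }
  let g : V →ₗ[ℝ] ℝ :=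
    { toFun := fun x => ∫ t, x.1 t * v t ∂μ
      map_add' := by
        intro a b
        rw [← integral_add a.2 b.2]
        congr 1; ext t; simp [add_mul]
      map_smul' := by
        intro c a
        rw [RingHom.id_apply, smul_eq_mul, ← integral_const_mul]
        congr 1; ext t; simp [mul_assoc] }
  obtain ⟨f, hf⟩ := LinearMap.exists_extend g
  have hfw : ∀ w, P.memLPhi w → f w = ∫ t, w t * v t ∂μ := by
    intro w hw
    have := LinearMap.congr_fun hf ⟨w, P.integrable_mul hw hv hv1⟩
    exact this
  refine ⟨f, ⟨?_, ?_⟩, hfw⟩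
  · refine IsGreatest.csSup_eq ⟨⟨(P.orliczNorm u)⁻¹ • u, P.mem_smul hu (inv_pos.2 hpos), ?_, ?_⟩, ?_⟩
    · refine (P.orlicz_smul_le hu (inv_pos.2 hpos)).trans ?_
      rw [inv_mul_cancel₀ hpos.ne']
    · rw [map_smul, hfw u hu, h, smul_eq_mul, inv_mul_cancel₀ hpos.ne', abs_one]
    · rintro r ⟨x, hx, hx1, rfl⟩
      rw [hfw x hx]
      exact (P.le_orlicz hx hv hv1).trans hx1
  · rw [hfw u hu, h]

end MOFunction

namespace MOFunction

lemma modular_le_mul (P : MOFunction T μ) {u : T → ℝ} {k : ℝ} (hk : 0 < k) :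
    P.modular (fun t => k * u t) ≤
      ENNReal.ofReal k * ∫⁻ t, ENNReal.ofReal |u t| * P.bConj t ∂μ := by
  rw [← lintegral_const_mul' _ _ ofReal_ne_top]
  refine lintegral_mono_ae ?_
  filter_upwards [P.ae_good] with t G
  refine (G.le_mul_bj _).trans (le_of_eq ?_)
  rw [← mul_assoc, ← ENNReal.ofReal_mul hk.le, abs_mul, abs_of_pos hk]
  rfl

lemma modular_slope (P : MOFunction T μ) {u : T → ℝ} {k j : ℝ} (hk : 0 < k) (hkj : k ≤ j) :
    ENNReal.ofReal j * P.modular (fun t => k * u t) ≤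
      ENNReal.ofReal k * P.modular (fun t => j * u t) := by
  unfold modular
  rw [← lintegral_const_mul' _ _ ofReal_ne_top, ← lintegral_const_mul' _ _ ofReal_ne_top]
  refine lintegral_mono_ae ?_
  filter_upwards [P.ae_good] with t G
  have hj : 0 < j := hk.trans_le hkj
  have h1 := G.mono_slope (p := Real.toNNReal (j / k))
    (by rw [Real.one_le_toNNReal, one_le_div hk]; exact hkj) (ENNReal.ofReal |k * u t|)
  have e1 : ((Real.toNNReal (j / k) : ℝ≥0) : ℝ≥0∞) = ENNReal.ofReal (j / k) := rfl
  rw [e1, ← ENNReal.ofReal_mul (by positivity)] at h1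
  have e2 : j / k * |k * u t| = |j * u t| := by
    rw [abs_mul, abs_mul, abs_of_pos hk, abs_of_pos hj]; field_simp
  rw [e2] at h1
  have e3 : ENNReal.ofReal j = ENNReal.ofReal k * ENNReal.ofReal (j / k) := by
    rw [← ENNReal.ofReal_mul hk.le]; congr 1; field_simp
  rw [e3, mul_assoc]
  gcongr

lemma lint_b_eq (P : MOFunction T μ) {u : T → ℝ} (hu : Measurable u) :
    ∫⁻ t, ENNReal.ofReal |u t| * P.bConj t ∂μ =
      ⨆ n : ℕ, P.modular (fun t => (n + 1 : ℝ) * u t) / ENNReal.ofReal (n + 1 : ℝ) := by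
  have hn : ∀ n : ℕ, (0 : ℝ) < n + 1 := fun n => by positivity
  have e : ∀ n : ℕ, P.modular (fun t => (n + 1 : ℝ) * u t) / ENNReal.ofReal (n + 1 : ℝ) =
      ∫⁻ t, P.toFun t (ENNReal.ofReal |(n + 1 : ℝ) * u t|) / ENNReal.ofReal (n + 1 : ℝ) ∂μ := by
    intro n
    simp only [div_eq_mul_inv]
    rw [lintegral_mul_const' _ _ (by simp [hn n]; try positivity)]
    rfl
  simp_rw [e]
  rw [← lintegral_iSup']
  · refine lintegral_congr_ae ?_
    filter_upwards [P.ae_good] with t G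
    rcases eq_or_ne (u t) 0 with h0 | h0
    · simp [h0, G.zero]
    have := G.iSup_eq (Real.toNNReal |u t|) (by simpa using h0)
    rw [bConj_eq]
    refine Eq.trans this.symm ?_
    congr 1; ext n
    have e1 : (((n : ℝ≥0) + 1 : ℝ≥0) : ℝ≥0∞) = ENNReal.ofReal (n + 1 : ℝ) := by
      rw [ENNReal.ofReal]; congr 1; ext; simp [(hn n).le]
    rw [ENNReal.coe_mul, e1, abs_mul, abs_of_pos (hn n), ENNReal.ofReal_mul (hn n).le]
    rfl
  · intro n
    exact (P.aem_toFun (aem_abs (hu.const_mul _))).div_const _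
  · filter_upwards [P.ae_good] with t G
    refine monotone_nat_of_le_succ fun n => ?_
    have hx : (0:ℝ≥0∞) < ENNReal.ofReal (n + 1 : ℝ) := by simpa using hn n
    have hy : (0:ℝ≥0∞) < ENNReal.ofReal ((n + 1 : ℕ) + 1 : ℝ) := by
      simpa only [ENNReal.ofReal_pos] using hn (n + 1)
    have hle : (n + 1 : ℝ) ≤ ((n + 1 : ℕ) + 1 : ℝ) := by push_cast; linarith
    rw [ENNReal.div_le_iff hx.ne' ofReal_ne_top, mul_comm (_ / _), ← mul_div_assoc,
      ENNReal.le_div_iff_mul_le (Or.inl hy.ne') (Or.inl ofReal_ne_top)]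
    have h1 := G.mono_slope (p := Real.toNNReal (((n + 1 : ℕ) + 1 : ℝ) / (n + 1)))
      (by rw [Real.one_le_toNNReal, one_le_div (hn n)]; exact hle)
      (ENNReal.ofReal |(n + 1 : ℝ) * u t|)
    have e1 : ∀ r : ℝ, ((Real.toNNReal r : ℝ≥0) : ℝ≥0∞) = ENNReal.ofReal r := fun _ => rfl
    rw [e1, ← ENNReal.ofReal_mul (by positivity)] at h1
    have e2 : ((n + 1 : ℕ) + 1 : ℝ) / (n + 1) * |(n + 1 : ℝ) * u t| =
        |((n + 1 : ℕ) + 1 : ℝ) * u t| := by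
      rw [abs_mul, abs_mul, abs_of_pos (hn n), abs_of_pos (hn (n + 1))]; field_simp
    rw [e2] at h1
    have e3 : ENNReal.ofReal ((n + 1 : ℕ) + 1 : ℝ) =
        ENNReal.ofReal (n + 1 : ℝ) * ENNReal.ofReal (((n + 1 : ℕ) + 1 : ℝ) / (n + 1)) := by
      rw [← ENNReal.ofReal_mul (hn n).le]; congr 1; field_simp
    rw [mul_comm, e3, mul_assoc]
    gcongr

lemma K_nonempty (P : MOFunction T μ) {u : T → ℝ} (hu : P.memLPhi u)
    (h : P.amemiya u < ∫⁻ t, ENNReal.ofReal |u t| * P.bConj t ∂μ) : (P.Kset u).Nonempty := by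
  set m := P.amemiya u with hm
  rw [P.lint_b_eq hu.1] at h
  obtain ⟨n, hn⟩ := lt_iSup_iff.1 h
  set k0 : ℝ := n + 1 with hk0
  have hk0p : 0 < k0 := by positivity
  obtain ⟨E, hmE, hED⟩ := exists_between hn
  obtain ⟨r, -, hr, hrlim⟩ := exists_seq_strictAnti_tendsto' hmE
  have hEt : E ≠ ⊤ := hED.ne_top
  have hE0 : 0 < E.toReal := ENNReal.toReal_pos (zero_le.trans_lt hmE).ne' hEt
  have hch : ∀ n, ∃ k : ℝ, 0 < k ∧ 1 + P.modular (fun t => k * u t) ≤ r n * ENNReal.ofReal k := by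
    intro n
    have h1 := (hr n).1
    rw [hm] at h1
    unfold amemiya at h1
    obtain ⟨k, hk⟩ := iInf_lt_iff.1 h1
    obtain ⟨hk1, hk2⟩ := iInf_lt_iff.1 hk
    have hk1' : 0 < k := hk1
    refine ⟨k, hk1', ?_⟩
    exact (ENNReal.div_le_iff (by simpa using hk1') ofReal_ne_top).1 hk2.le
  choose k hk hkr using hch
  have hmem : ∀ n, k n ∈ Set.Icc (E.toReal⁻¹) k0 := by
    intro n
    have h1 : 1 + P.modular (fun t => k n * u t) ≤ E * ENNReal.ofReal (k n) :=
      (hkr n).trans (by gcongr; exact (hr n).2.le)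
    constructor
    · have h2 : 1 ≤ E * ENNReal.ofReal (k n) := le_self_add.trans h1
      rw [← ENNReal.ofReal_toReal hEt, ← ENNReal.ofReal_mul hE0.le, ENNReal.one_le_ofReal] at h2
      rwa [inv_le_iff_one_le_mul₀' hE0]
    · by_contra! hlt
      have h2 := P.modular_slope (u := u) hk0p hlt.le
      have h3 : E * ENNReal.ofReal k0 < P.modular (fun t => k0 * u t) := by
        rwa [ENNReal.lt_div_iff_mul_lt (Or.inl (by simpa using hk0p)) (Or.inl ofReal_ne_top)] at hED
      have hkn : ENNReal.ofReal (k n) ≠ 0 := by simpa using hk n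
      have h4 : ENNReal.ofReal (k n) * (E * ENNReal.ofReal k0) <
          ENNReal.ofReal (k n) * P.modular (fun t => k0 * u t) :=
        (ENNReal.mul_lt_mul_iff_right hkn ofReal_ne_top).2 h3
      refine (h4.trans_le h2).not_ge ?_
      calc _ ≤ ENNReal.ofReal k0 * (E * ENNReal.ofReal (k n)) := by
            gcongr; exact le_add_self.trans h1
        _ = _ := by ring
  obtain ⟨kk, hkk, s, hs, hlim⟩ := isCompact_Icc.tendsto_subseq hmem
  have hkkp : 0 < kk := lt_of_lt_of_le (inv_pos.2 hE0) hkk.1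
  have hmt : m ≠ ⊤ := hmE.ne_top
  have hkl : Tendsto (fun j => ENNReal.ofReal (k (s j))) atTop (𝓝 (ENNReal.ofReal kk)) :=
    ENNReal.tendsto_ofReal hlim
  have hlim2 : Tendsto (fun j => r (s j) * ENNReal.ofReal (k (s j))) atTop
      (𝓝 (m * ENNReal.ofReal kk)) :=
    ENNReal.Tendsto.mul (hrlim.comp hs.tendsto_atTop) (Or.inr ofReal_ne_top) hkl (Or.inr hmt)
  have hge1 : 1 ≤ m * ENNReal.ofReal kk :=
    ge_of_tendsto' hlim2 fun j => le_self_add.trans (hkr (s j))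
  have hlim3 : Tendsto (fun j => r (s j) * ENNReal.ofReal (k (s j)) - 1) atTop
      (𝓝 (m * ENNReal.ofReal kk - 1)) :=
    ENNReal.Tendsto.sub hlim2 tendsto_const_nhds (Or.inr one_ne_top)
  have hF : P.modular (fun t => kk * u t) ≤
      liminf (fun j => P.modular (fun t => k (s j) * u t)) atTop := by
    unfold modular
    refine le_trans (lintegral_mono_ae ?_) (lintegral_liminf_le'
      (fun j => P.aem_toFun (aem_abs (hu.1.const_mul _))))
    filter_upwards [P.ae_good] with t G
    have hc : Tendsto (fun j => ENNReal.ofReal |k (s j) * u t|) atTop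
        (𝓝 (ENNReal.ofReal |kk * u t|)) :=
      ENNReal.tendsto_ofReal ((hlim.mul_const (u t)).abs)
    refine le_of_forall_lt fun c hcl => ?_
    obtain ⟨d, hcd, hd⟩ := exists_between hcl
    refine hcd.trans_le (le_liminf_of_le (by isBoundedDefault) ?_)
    filter_upwards [hc.eventually (G.lsc _ d hd)] with j hj using hj.le
  have hI : P.modular (fun t => kk * u t) ≤ m * ENNReal.ofReal kk - 1 := by
    refine hF.trans ?_
    rw [← hlim3.liminf_eq]
    refine liminf_le_liminf (Eventually.of_forall fun j => ?_)
    refine ENNReal.le_sub_of_add_le_left one_ne_top (hkr (s j))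
  refine ⟨kk, hkkp, le_antisymm ?_ ?_⟩
  · rw [ENNReal.div_le_iff (by simpa using hkkp) ofReal_ne_top]
    calc _ ≤ 1 + (m * ENNReal.ofReal kk - 1) := by gcongr
      _ = _ := add_tsub_cancel_of_le hge1
  · exact iInf₂_le (f := fun (k : ℝ) (_ : k ∈ Set.Ioi (0:ℝ)) =>
      (1 + P.modular (fun t => k * u t)) / ENNReal.ofReal k) kk hkkp

lemma key_le_one (P : MOFunction T μ) {u : T → ℝ} (hu : P.memLPhi u) (hK : P.Kset u = ∅) :
    ∫⁻ t in {t | u t ≠ 0}, P.conj t (P.bConj t) ∂μ ≤ 1 := by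
  have hle : ∫⁻ t, ENNReal.ofReal |u t| * P.bConj t ∂μ ≤ P.amemiya u := by
    by_contra! h
    have := P.K_nonempty hu h
    rw [hK] at this
    exact Set.not_nonempty_empty this
  have ham : ∀ k : ℝ, 0 < k → ENNReal.ofReal k * P.amemiya u ≤ 1 + P.modular (fun t => k * u t) := by
    intro k hk
    rw [mul_comm, ← ENNReal.le_div_iff_mul_le (Or.inl (by simpa using hk)) (Or.inl ofReal_ne_top)]
    exact iInf₂_le (f := fun (k : ℝ) (_ : k ∈ Set.Ioi (0:ℝ)) =>
      (1 + P.modular (fun t => k * u t)) / ENNReal.ofReal k) k hk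
  have hmt : P.amemiya u < ⊤ := by
    obtain ⟨-, l, hl, hl2⟩ := hu
    have := (ham l hl).trans_lt (ENNReal.add_lt_top.2 ⟨one_lt_top, hl2⟩)
    by_contra! h
    rw [top_le_iff.1 h, ENNReal.mul_top (by simpa using hl)] at this
    simp at this
  have hIt := hle.trans_lt hmt
  have hmeas : AEMeasurable (fun t => ENNReal.ofReal |u t| * P.bConj t) μ :=
    (aem_abs hu.1).mul P.aem_b
  let F : ℕ → T → ℝ≥0∞ := fun n t =>
    ENNReal.ofReal (n + 1) * (ENNReal.ofReal |u t| * P.bConj t) -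
      P.toFun t (ENNReal.ofReal |(n + 1 : ℝ) * u t|)
  have hFm : ∀ n, AEMeasurable (F n) μ := fun n =>
    (hmeas.const_mul _).sub (P.aem_toFun (aem_abs (hu.1.const_mul _)))
  have hF1 : ∀ n, ∫⁻ t, F n t ∂μ ≤ 1 := by
    intro n
    have hn : (0:ℝ) < n + 1 := by positivity
    have h1 := P.modular_le_mul (u := u) hn
    have hfin : P.modular (fun t => (n + 1 : ℝ) * u t) ≠ ⊤ :=
      (h1.trans_lt (ENNReal.mul_lt_top ofReal_lt_top hIt)).ne
    have := lintegral_sub' (μ := μ) (f := fun t => ENNReal.ofReal (n + 1 : ℝ) * (ENNReal.ofReal |u t| * P.bConj t))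
      (P.aem_toFun (aem_abs (hu.1.const_mul (n + 1 : ℝ)))) hfin (by
        filter_upwards [P.ae_good] with t G
        refine (G.le_mul_bj _).trans (le_of_eq ?_)
        rw [← mul_assoc, ← ENNReal.ofReal_mul hn.le, abs_mul, abs_of_pos hn]
        rfl)
    change ∫⁻ t, ENNReal.ofReal (n + 1) * (ENNReal.ofReal |u t| * P.bConj t) -
      P.toFun t (ENNReal.ofReal |(n + 1 : ℝ) * u t|) ∂μ ≤ 1
    rw [this, lintegral_const_mul' _ _ ofReal_ne_top, tsub_le_iff_right]
    refine le_trans ?_ (ham _ hn)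
    gcongr
  have hbf : ∀ᵐ t ∂μ, ENNReal.ofReal |u t| * P.bConj t < ⊤ := ae_lt_top' hmeas hIt.ne
  have hS : MeasurableSet {t | u t ≠ 0} := hu.1 (measurableSet_singleton 0).compl
  calc ∫⁻ t in {t | u t ≠ 0}, P.conj t (P.bConj t) ∂μ
      ≤ ∫⁻ t in {t | u t ≠ 0}, liminf (fun n => F n t) atTop ∂μ := by
        refine lintegral_mono_ae ?_
        rw [ae_restrict_iff' hS]
        filter_upwards [P.ae_good, hbf] with t G hb hut
        have hut' : 0 < |u t| := abs_pos.2 hut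
        have hbt : bj (P.toFun t) ≠ ⊤ := by
          intro h
          rw [bConj_eq, h, ENNReal.mul_top (by simpa using hut)] at hb
          simp at hb
        refine G.cj_le fun x hx => ?_
        rw [← tsub_le_iff_left]
        refine le_liminf_of_le (by isBoundedDefault) ?_
        obtain ⟨N, hN⟩ := exists_nat_ge (x / |u t| : ℝ)
        filter_upwards [eventually_ge_atTop N] with n hn
        have hn0 : (0:ℝ) < n + 1 := by positivity
        set y : ℝ≥0 := Real.toNNReal |(n + 1 : ℝ) * u t| with hy
        have hFy : F n t = y * bj (P.toFun t) - P.toFun t y := by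
          simp only [F]
          rw [← mul_assoc, ← ENNReal.ofReal_mul hn0.le, bConj_eq]
          have : (n + 1 : ℝ) * |u t| = |(n + 1 : ℝ) * u t| := by rw [abs_mul, abs_of_pos hn0]
          rw [this]; rfl
        have hxy : x ≤ y := by
          rw [← NNReal.coe_le_coe, hy, Real.coe_toNNReal _ (abs_nonneg _), abs_mul, abs_of_pos hn0,
            ← div_le_iff₀ hut']
          have : (N : ℝ) ≤ n := by exact_mod_cast hn
          linarith
        rw [hFy]
        have h1 := G.slope hxy
        have h2 := G.le_mul_bj y
        have h3 : P.toFun t y ≠ ⊤ := (h2.trans_lt (ENNReal.mul_lt_top coe_lt_top hbt.lt_top)).ne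
        rw [tsub_le_iff_left, ← ENNReal.add_le_add_iff_left h3]
        calc P.toFun t y + x * bj (P.toFun t)
            ≤ (P.toFun t x + (y - x : ℝ≥0) * bj (P.toFun t)) + x * bj (P.toFun t) := by gcongr
          _ = P.toFun t x + ((y - x + x : ℝ≥0) : ℝ≥0∞) * bj (P.toFun t) := by
            rw [ENNReal.coe_add]; ring
          _ = P.toFun t x + y * bj (P.toFun t) := by rw [tsub_add_cancel_of_le hxy]
          _ = P.toFun t x + (P.toFun t y + (y * bj (P.toFun t) - P.toFun t y)) := by
            rw [add_tsub_cancel_of_le h2]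
          _ = _ := by ring
    _ ≤ ∫⁻ t, liminf (fun n => F n t) atTop ∂μ := setLIntegral_le_lintegral _ _
    _ ≤ liminf (fun n => ∫⁻ t, F n t ∂μ) atTop := lintegral_liminf_le' hFm
    _ ≤ liminf (fun _ : ℕ => (1 : ℝ≥0∞)) atTop := liminf_le_liminf (Eventually.of_forall hF1)
    _ = 1 := by simp

end MOFunction

namespace MOFunction

/-- data attached to `u`: a measurable real version of `b` on the support of `u`. -/
structure Beta (P : MOFunction T μ) (u β : T → ℝ) : Prop where
  meas : Measurable β
  nonneg : ∀ t, 0 ≤ β t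
  off : ∀ t, u t = 0 → β t = 0
  eq : ∀ᵐ t ∂μ, u t ≠ 0 → ENNReal.ofReal (β t) = P.bConj t
  pos : ∀ᵐ t ∂μ, u t ≠ 0 → 0 < β t
  fin : ∀ᵐ t ∂μ, u t ≠ 0 → P.conj t (P.bConj t) ≠ ⊤

lemma meas_supp {u : T → ℝ} (hu : Measurable u) : MeasurableSet {t | u t ≠ 0} :=
  hu (measurableSet_singleton 0).compl

lemma exists_beta (P : MOFunction T μ) {u : T → ℝ} (hu : Measurable u)
    (hc : ∫⁻ t in {t | u t ≠ 0}, P.conj t (P.bConj t) ∂μ ≤ 1) : ∃ β, Beta P u β := by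
  have hS := meas_supp hu
  have hfin : ∀ᵐ t ∂μ, u t ≠ 0 → P.conj t (P.bConj t) < ⊤ := by
    have := ae_lt_top' (P.aem_conj P.aem_b).restrict (hc.trans_lt one_lt_top).ne
    rwa [ae_restrict_iff' hS] at this
  have hm : AEMeasurable (fun t => (P.bConj t).toReal) μ := P.aem_b.ennreal_toReal
  have hbt : ∀ᵐ t ∂μ, u t ≠ 0 → P.bConj t ≠ ⊤ := by
    filter_upwards [P.ae_good, hfin] with t G h hut hb
    have := h hut
    rw [hb, conj_eq, G.cj_top] at this
    simp at this
  refine ⟨Set.indicator {t | u t ≠ 0} (fun t => |hm.mk _ t|), ?_, ?_, ?_, ?_, ?_, ?_⟩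
  · exact (hm.measurable_mk.abs).indicator hS
  · intro t; exact Set.indicator_nonneg (fun _ _ => abs_nonneg _) t
  · intro t ht; simp [ht]
  · filter_upwards [hm.ae_eq_mk, hbt] with t h1 h2 hut
    rw [Set.indicator_of_mem (by exact hut), ← h1, abs_of_nonneg ENNReal.toReal_nonneg,
      ENNReal.ofReal_toReal (h2 hut)]
  · filter_upwards [hm.ae_eq_mk, hbt, P.ae_good] with t h1 h2 G hut
    rw [Set.indicator_of_mem (by exact hut), ← h1, abs_of_nonneg ENNReal.toReal_nonneg]
    exact ENNReal.toReal_pos G.bj_pos.ne' (h2 hut)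
  · filter_upwards [hfin] with t h hut using (h hut).ne

/-- the basic family of functionals -/
def vf (u β : T → ℝ) (A : Set T) (ε : ℝ) : T → ℝ :=
  fun t => u t / |u t| * β t + A.indicator (fun _ => ε) t

lemma vf_meas {u β : T → ℝ} (hu : Measurable u) (hβ : Measurable β) {A : Set T}
    (hA : MeasurableSet A) (ε : ℝ) : Measurable (vf u β A ε) :=
  ((hu.div hu.abs).mul hβ).add (measurable_const.indicator hA)

lemma mul_vf {u β : T → ℝ} {A : Set T} (hAu : ∀ t ∈ A, u t = 0) (ε : ℝ) (t : T) :
    u t * vf u β A ε t = |u t| * β t := by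
  unfold vf
  by_cases h : u t = 0
  · simp [h]
  have h2 : t ∉ A := fun h3 => h (hAu t h3)
  have h3 : |u t| ≠ 0 := abs_ne_zero.2 h
  rw [Set.indicator_of_notMem h2, add_zero, ← mul_assoc, ← mul_div_assoc, ← abs_mul_abs_self (u t),
    mul_div_assoc, div_self h3, mul_one]

lemma modular_vf (P : MOFunction T μ) {u β : T → ℝ} (hu : Measurable u) (hβ : Beta P u β)
    {A : Set T} (hA : MeasurableSet A) (hAu : ∀ t ∈ A, u t = 0) {ε : ℝ} (hε : 0 ≤ ε) :
    P.modularConj (vf u β A ε) ≤ ∫⁻ t in {t | u t ≠ 0}, P.conj t (P.bConj t) ∂μ +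
      ∫⁻ t in A, P.conj t (ENNReal.ofReal ε) ∂μ := by
  have hS := meas_supp hu
  rw [← lintegral_indicator hS, ← lintegral_indicator hA,
    ← lintegral_add_left' ((P.aem_conj P.aem_b).indicator hS)]
  refine lintegral_mono_ae ?_
  filter_upwards [hβ.eq] with t h
  by_cases hut : u t = 0
  · by_cases htA : t ∈ A
    · simp [vf, hut, htA, abs_of_nonneg hε]
    · simp [vf, hut, htA, conj_eq, cj_zero]
  · have htA : t ∉ A := fun h3 => hut (hAu t h3)
    have h3 : |u t| ≠ 0 := abs_ne_zero.2 hut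
    have e : |vf u β A ε t| = β t := by
      simp [vf, htA, abs_mul, abs_div, div_self h3, abs_of_nonneg (hβ.nonneg t)]
    rw [e, h hut, Set.indicator_of_mem (by exact hut)]
    exact le_self_add

lemma integrable_beta (P : MOFunction T μ) {u β : T → ℝ} (hu : Measurable u) (hβ : Beta P u β)
    (hc : ∫⁻ t in {t | u t ≠ 0}, P.conj t (P.bConj t) ∂μ ≤ 1) {x : T → ℝ} (hx : P.memLPhi x) :
    Integrable (fun t => x t * β t) μ := by
  refine P.integrable_mul hx hβ.meas ?_
  refine le_trans ?_ hc
  have hS := meas_supp hu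
  rw [← lintegral_indicator hS]
  refine lintegral_mono_ae ?_
  filter_upwards [hβ.eq] with t h
  by_cases hut : u t = 0
  · simp [hut, hβ.off t hut, conj_eq, cj_zero]
  · rw [abs_of_nonneg (hβ.nonneg t), h hut, Set.indicator_of_mem (by exact hut)]

lemma integrable_abs_beta (P : MOFunction T μ) {u β : T → ℝ} (hu : Measurable u) (hβ : Beta P u β)
    (hc : ∫⁻ t in {t | u t ≠ 0}, P.conj t (P.bConj t) ∂μ ≤ 1) {x : T → ℝ} (hx : P.memLPhi x) :
    Integrable (fun t => |x t| * β t) μ := by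
  refine (P.integrable_beta hu hβ hc hx).abs.congr (Eventually.of_forall fun t => ?_)
  simp [abs_mul, abs_of_nonneg (hβ.nonneg t)]

lemma ofReal_int_beta (P : MOFunction T μ) {u β : T → ℝ} (hu : Measurable u) (hβ : Beta P u β)
    (hc : ∫⁻ t in {t | u t ≠ 0}, P.conj t (P.bConj t) ∂μ ≤ 1) {x : T → ℝ} (hx : P.memLPhi x) :
    ENNReal.ofReal (∫ t, |x t| * β t ∂μ) = ∫⁻ t in {t | u t ≠ 0}, ENNReal.ofReal |x t| * P.bConj t ∂μ := by
  rw [ofReal_integral_eq_lintegral_ofReal (P.integrable_abs_beta hu hβ hc hx)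
    (Eventually.of_forall fun t => mul_nonneg (abs_nonneg _) (hβ.nonneg t)),
    ← lintegral_indicator (meas_supp hu)]
  refine lintegral_congr_ae ?_
  filter_upwards [hβ.eq] with t h
  by_cases hut : u t = 0
  · simp [hut, hβ.off t hut]
  · rw [ENNReal.ofReal_mul (abs_nonneg _), h hut, Set.indicator_of_mem (by exact hut)]

lemma int_beta_nonneg {P : MOFunction T μ} {u β : T → ℝ} (hβ : Beta P u β) (x : T → ℝ) :
    0 ≤ ∫ t, |x t| * β t ∂μ :=
  integral_nonneg fun t => mul_nonneg (abs_nonneg _) (hβ.nonneg t)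

/-- if `x` vanishes off the support of `u` then its norm is at most `∫ |x| b`. -/
lemma orlicz_le_beta (P : MOFunction T μ) {u β : T → ℝ} (hu : Measurable u) (hβ : Beta P u β)
    (hc : ∫⁻ t in {t | u t ≠ 0}, P.conj t (P.bConj t) ∂μ ≤ 1) {x : T → ℝ} (hx : P.memLPhi x)
    (hx0 : ∀ᵐ t ∂μ, u t = 0 → x t = 0) : P.orliczNorm x ≤ ∫ t, |x t| * β t ∂μ := by
  refine P.orlicz_le (int_beta_nonneg hβ x) fun v hv hv1 => ?_
  refine abs_int_le (int_beta_nonneg hβ x) ?_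
  rw [P.ofReal_int_beta hu hβ hc hx, ← lintegral_indicator (meas_supp hu)]
  refine lintegral_mono_ae ?_
  have hfin := ae_lt_top' (P.aem_conj (aem_abs hv)) (hv1.trans_lt one_lt_top).ne
  filter_upwards [hx0, hfin] with t h1 h2
  by_cases hut : u t = 0
  · simp [h1 hut]
  · rw [Set.indicator_of_mem (by exact hut)]
    gcongr
    exact le_bj h2

lemma orlicz_u (P : MOFunction T μ) {u β : T → ℝ} (hu : P.memLPhi u) (hβ : Beta P u β)
    (hc : ∫⁻ t in {t | u t ≠ 0}, P.conj t (P.bConj t) ∂μ ≤ 1) :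
    P.orliczNorm u = ∫ t, |u t| * β t ∂μ := by
  refine le_antisymm (P.orlicz_le_beta hu.1 hβ hc hu (Eventually.of_forall fun t h => h)) ?_
  have h1 : P.modularConj (vf u β ∅ 0) ≤ 1 :=
    (P.modular_vf hu.1 hβ MeasurableSet.empty (by simp) le_rfl).trans (by simpa using hc)
  refine le_trans (le_of_eq ?_) ((le_abs_self _).trans
    (P.le_orlicz hu (vf_meas hu.1 hβ.meas MeasurableSet.empty 0) h1))
  simp_rw [mul_vf (u := u) (β := β) (A := ∅) (by simp) 0]

lemma orlicz_u_pos (P : MOFunction T μ) {u β : T → ℝ} (hu : P.memLPhi u) (hβ : Beta P u β)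
    (hc : ∫⁻ t in {t | u t ≠ 0}, P.conj t (P.bConj t) ∂μ ≤ 1) (hne : ¬ u =ᵐ[μ] 0) :
    0 < P.orliczNorm u := by
  rw [P.orlicz_u hu hβ hc]
  refine lt_of_le_of_ne (int_beta_nonneg hβ u) fun h => hne ?_
  have := (integral_eq_zero_iff_of_nonneg (fun t => mul_nonneg (abs_nonneg _) (hβ.nonneg t))
    (P.integrable_abs_beta hu.1 hβ hc hu)).1 h.symm
  filter_upwards [this, hβ.pos] with t h1 h2
  by_contra h3
  have : 0 < |u t| * β t := mul_pos (abs_pos.2 h3) (h2 h3)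
  exact this.ne' h1

lemma vf_support (P : MOFunction T μ) {u β : T → ℝ} (hu : P.memLPhi u) (hβ : Beta P u β)
    (hc : ∫⁻ t in {t | u t ≠ 0}, P.conj t (P.bConj t) ∂μ ≤ 1) (hne : ¬ u =ᵐ[μ] 0)
    {A : Set T} (hA : MeasurableSet A) (hAu : ∀ t ∈ A, u t = 0) {ε : ℝ} (hε : 0 ≤ ε)
    (hA1 : ∫⁻ t in {t | u t ≠ 0}, P.conj t (P.bConj t) ∂μ +
      ∫⁻ t in A, P.conj t (ENNReal.ofReal ε) ∂μ ≤ 1) :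
    ∃ f : (T → ℝ) →ₗ[ℝ] ℝ, P.IsSupportAt f u ∧
      ∀ w, P.memLPhi w → f w = ∫ t, w t * vf u β A ε t ∂μ := by
  refine P.exists_support hu (vf_meas hu.1 hβ.meas hA ε)
    ((P.modular_vf hu.1 hβ hA hAu hε).trans hA1) ?_ (P.orlicz_u_pos hu hβ hc hne)
  rw [P.orlicz_u hu hβ hc]
  simp_rw [mul_vf hAu ε]

lemma not_smooth (P : MOFunction T μ) {u β : T → ℝ} (hu : P.memLPhi u) (hβ : Beta P u β)
    (hc : ∫⁻ t in {t | u t ≠ 0}, P.conj t (P.bConj t) ∂μ ≤ 1) (hne : ¬ u =ᵐ[μ] 0)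
    {A : Set T} (hA : MeasurableSet A) (hAu : ∀ t ∈ A, u t = 0) {ε : ℝ} (hε : 0 < ε)
    (hA1 : ∫⁻ t in {t | u t ≠ 0}, P.conj t (P.bConj t) ∂μ +
      ∫⁻ t in A, P.conj t (ENNReal.ofReal ε) ∂μ ≤ 1)
    (hμ : 0 < μ A) (hμt : μ A < ⊤) (hφ : ∀ᵐ t ∂μ, t ∈ A → P.toFun t (ENNReal.ofReal ε) ≤ 1) :
    ¬ P.IsSmoothPoint u := by
  rintro ⟨-, hun⟩
  obtain ⟨f, hf, hfw⟩ := P.vf_support hu hβ hc hne hA hAu hε.le hA1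
  obtain ⟨g, hg, hgw⟩ := P.vf_support hu hβ hc hne MeasurableSet.empty (by simp) (ε := 0) le_rfl
    (by simpa using hc)
  have hw : P.memLPhi (A.indicator 1) := by
    refine ⟨measurable_one.indicator hA, ε, hε, ?_⟩
    refine lt_of_le_of_lt ?_ hμt
    rw [← lintegral_indicator_one hA]
    refine lintegral_mono_ae ?_
    filter_upwards [P.ae_good, hφ] with t G h
    by_cases ht : t ∈ A
    · simpa [ht, abs_of_pos hε] using h ht
    · simp [ht, G.zero]
  have := hun f g hf hg _ hw
  rw [hfw _ hw, hgw _ hw] at this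
  have e1 : ∀ t, A.indicator (1 : T → ℝ) t * vf u β A ε t = A.indicator (fun _ => ε) t := by
    intro t
    by_cases ht : t ∈ A
    · simp [ht, vf, hAu t ht]
    · simp [ht]
  have e2 : ∀ t, A.indicator (1 : T → ℝ) t * vf u β ∅ 0 t = 0 := by
    intro t
    by_cases ht : t ∈ A
    · simp [ht, vf, hAu t ht]
    · simp [ht]
  simp_rw [e1, e2] at this
  rw [integral_indicator hA, setIntegral_const, integral_zero, smul_eq_mul] at this
  have h3 : 0 < μ.real A := ENNReal.toReal_pos hμ.ne' hμt.ne
  exact (mul_pos h3 hε).ne' this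

lemma pick [SigmaFinite μ] (P : MOFunction T μ) {u : T → ℝ} (hu : Measurable u) (δ : ℝ≥0∞) (m : ℕ)
    (h : ¬ ∀ᵐ t ∂μ, t ∈ spanningSets μ m → u t = 0 →
      ∀ ε : ℝ≥0, 0 < ε → δ < P.conj t ε) :
    ∃ (A : Set T) (ε : ℝ), 0 < ε ∧ MeasurableSet A ∧ A ⊆ spanningSets μ m ∧ (∀ t ∈ A, u t = 0) ∧
      0 < μ A ∧ (∀ᵐ t ∂μ, t ∈ A → P.toFun t (ENNReal.ofReal ε) ≤ 1) ∧
      (∀ᵐ t ∂μ, t ∈ A → P.conj t (ENNReal.ofReal ε) ≤ δ) := by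
  let e : ℕ → ℝ := fun n => 1 / (n + 1 : ℝ)
  have he : ∀ n, 0 < e n := fun n => by positivity
  let E : ℕ → Set T := fun n => {t | t ∈ spanningSets μ m ∧ u t = 0 ∧
    P.toFun t (ENNReal.ofReal (e n)) ≤ 1 ∧ P.conj t (ENNReal.ofReal (e n)) ≤ δ}
  have hE : ∃ n, μ (E n) ≠ 0 := by
    by_contra! hcon
    apply h
    have hall : ∀ᵐ t ∂μ, ∀ n, t ∉ E n := ae_all_iff.2 fun n => measure_eq_zero_iff_ae_notMem.1 (hcon n)
    filter_upwards [hall, P.ae_good] with t ht G hts hut ε hε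
    by_contra! hcj
    obtain ⟨x, hx, hxφ⟩ := G.exists_fin
    have hmin : 0 < min (x : ℝ) ε := lt_min (by exact_mod_cast hx) (by exact_mod_cast hε)
    obtain ⟨n, hn⟩ := exists_nat_one_div_lt hmin
    refine ht n ⟨hts, hut, (G.mono ?_).trans hxφ, (cj_mono _ ?_).trans hcj⟩
    · exact ENNReal.ofReal_le_of_le_toReal (hn.le.trans (min_le_left _ _))
    · exact ENNReal.ofReal_le_of_le_toReal (hn.le.trans (min_le_right _ _))
  obtain ⟨n, hn⟩ := hE
  have hEm : NullMeasurableSet (E n) μ := by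
    have h1 : NullMeasurableSet {t | P.toFun t (ENNReal.ofReal (e n)) ≤ 1} μ :=
      nullMeasurableSet_le (P.measurable' _).aemeasurable aemeasurable_const
    have h2 : NullMeasurableSet {t | P.conj t (ENNReal.ofReal (e n)) ≤ δ} μ :=
      nullMeasurableSet_le (P.aem_conj aemeasurable_const) aemeasurable_const
    exact (measurableSet_spanningSets μ m).nullMeasurableSet.inter
      ((hu (measurableSet_singleton 0)).nullMeasurableSet.inter (h1.inter h2))
  obtain ⟨A, hAE, hA, hAe⟩ := hEm.exists_measurable_subset_ae_eq
  refine ⟨A, e n, he n, hA, fun t ht => (hAE ht).1, fun t ht => (hAE ht).2.1, ?_,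
    Eventually.of_forall fun t ht => (hAE ht).2.2.1, Eventually.of_forall fun t ht => (hAE ht).2.2.2⟩
  rw [measure_congr hAe]
  exact pos_iff_ne_zero.2 hn

lemma smooth_imp [SigmaFinite μ] (P : MOFunction T μ) {u : T → ℝ} (hu : P.memLPhi u)
    (hc : ∫⁻ t in {t | u t ≠ 0}, P.conj t (P.bConj t) ∂μ ≤ 1) (hne : ¬ u =ᵐ[μ] 0)
    (hs : P.IsSmoothPoint u) :
      (((∫⁻ t in {t | u t ≠ 0}, P.conj t (P.bConj t) ∂μ) = 1 ∧
        ∀ᵐ t ∂μ, u t = 0 → P.aConj t = 0) ∨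
       ((∫⁻ t, P.conj t (P.bConj t) ∂μ) < 1 ∧ μ {t | u t = 0} = 0)) := by
  obtain ⟨β, hβ⟩ := P.exists_beta hu.1 hc
  rcases hc.eq_or_lt with h1 | h1
  · left
    refine ⟨h1, ?_⟩
    by_contra hcon
    have : ∃ m, ¬ ∀ᵐ t ∂μ, t ∈ spanningSets μ m → u t = 0 →
      ∀ ε : ℝ≥0, 0 < ε → 0 < P.conj t ε := by
      by_contra! hall
      apply hcon
      filter_upwards [ae_all_iff.2 hall] with t ht hut
      obtain ⟨m, hm⟩ := Set.mem_iUnion.1 ((iUnion_spanningSets μ).symm ▸ Set.mem_univ t :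
        t ∈ ⋃ i, spanningSets μ i)
      refine le_antisymm (sSup_le fun v hv => ?_) zero_le
      by_contra! hv0
      obtain ⟨ε, he1, he2⟩ := ENNReal.lt_iff_exists_nnreal_btwn.1 hv0
      have h2 := ht m hm hut ε (by exact_mod_cast he1)
      have h3 : P.conj t ε ≤ P.conj t v := cj_mono _ he2.le
      rw [hv] at h3
      exact h2.not_ge h3
    obtain ⟨m, hm⟩ := this
    obtain ⟨A, ε, hε, hA, hAs, hAu, hA0, hAφ, hAψ⟩ := P.pick hu.1 0 m hm
    refine P.not_smooth hu hβ hc hne hA hAu hε ?_ hA0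
      ((measure_mono hAs).trans_lt (measure_spanningSets_lt_top μ m)) hAφ hs
    have : ∫⁻ t in A, P.conj t (ENNReal.ofReal ε) ∂μ = 0 := by
      rw [setLIntegral_congr_fun_ae (g := fun _ => 0) hA (by
        filter_upwards [hAψ] with t h ht using le_antisymm (h ht) zero_le)]
      simp
    rw [this, add_zero]; exact hc
  · right
    have h0 : μ {t | u t = 0} = 0 := by
      by_contra hcon
      have : ∃ m, μ ({t | u t = 0} ∩ spanningSets μ m) ≠ 0 := by
        by_contra! hall
        apply hcon
        rw [← Set.inter_univ {t | u t = 0}, ← iUnion_spanningSets μ, Set.inter_iUnion]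
        exact measure_iUnion_null hall
      obtain ⟨m, hm⟩ := this
      set c := ∫⁻ t in {t | u t ≠ 0}, P.conj t (P.bConj t) ∂μ with hcdef
      have hmt := measure_spanningSets_lt_top μ m
      set δ : ℝ≥0∞ := (1 - c) / μ (spanningSets μ m) with hδ
      have hδ0 : 0 < δ := ENNReal.div_pos (tsub_pos_of_lt h1).ne' hmt.ne
      have hpk : ¬ ∀ᵐ t ∂μ, t ∈ spanningSets μ m → u t = 0 →
          ∀ ε : ℝ≥0, 0 < ε → δ < P.conj t ε := by
        intro hall
        apply hm
        rw [measure_eq_zero_iff_ae_notMem]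
        filter_upwards [hall, P.ae_good] with t ht G hmem
        obtain ⟨v, hv, hvc⟩ := G.exists_cj
        obtain ⟨p, hp, hpp⟩ := ENNReal.lt_iff_exists_nnreal_btwn.1 (lt_min hδ0 zero_lt_one)
        have hp' : 0 < p := by exact_mod_cast hp
        have h3 := ht hmem.2 hmem.1 (p * v) (mul_pos hp' hv)
        refine h3.not_ge ?_
        rw [ENNReal.coe_mul, conj_eq]
        calc _ ≤ (p : ℝ≥0∞) * cj (P.toFun t) v := cj_scale _ (hpp.le.trans (min_le_right _ _)) _
          _ ≤ p * 1 := by gcongr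
          _ ≤ δ := by rw [mul_one]; exact hpp.le.trans (min_le_left _ _)
      obtain ⟨A, ε, hε, hA, hAs, hAu, hA0, hAφ, hAψ⟩ := P.pick hu.1 δ m hpk
      refine P.not_smooth hu hβ hc hne hA hAu hε ?_ hA0
        ((measure_mono hAs).trans_lt (measure_spanningSets_lt_top μ m)) hAφ hs
      have : ∫⁻ t in A, P.conj t (ENNReal.ofReal ε) ∂μ ≤ 1 - c := by
        calc _ ≤ ∫⁻ t in A, δ ∂μ := by
              refine lintegral_mono_ae ?_
              rw [ae_restrict_iff' hA]; exact hAψ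
          _ = δ * μ A := by simp
          _ ≤ δ * μ (spanningSets μ m) := by gcongr
          _ ≤ _ := by rw [mul_comm]; exact ENNReal.mul_div_le
      calc _ ≤ c + (1 - c) := by gcongr
        _ = 1 := add_tsub_cancel_of_le hc
    refine ⟨?_, h0⟩
    refine lt_of_le_of_lt (le_of_eq ?_) h1
    rw [Measure.restrict_eq_self_of_ae_mem]
    filter_upwards [measure_eq_zero_iff_ae_notMem.1 h0] with t ht using ht

end MOFunction

namespace MOFunction

lemma support_le_int (P : MOFunction T μ) {u β : T → ℝ} (hu : P.memLPhi u) (hβ : Beta P u β)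
    (hc : ∫⁻ t in {t | u t ≠ 0}, P.conj t (P.bConj t) ∂μ ≤ 1)
    {f : (T → ℝ) →ₗ[ℝ] ℝ} (hf : P.IsSupportAt f u) {w : T → ℝ} (hw : P.memLPhi w)
    (hb : ∀ ε : ℝ, 0 < ε → ∃ h : ℝ, 0 < h ∧ ∀ᶠ n : ℕ in atTop,
      P.orliczNorm (u + (h / (n + 1)) • w) ≤
        ∫ t, |(u + (h / (n + 1)) • w) t| * β t ∂μ + ε * (h / (n + 1))) :
    f w ≤ ∫ t, w t * vf u β ∅ 0 t ∂μ := by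
  refine le_of_forall_pos_le_add fun ε hε => ?_
  obtain ⟨h, hh, hev⟩ := hb ε hε
  have hs : ∀ n : ℕ, 0 < h / (n + 1 : ℝ) := fun n => by positivity
  have hlim0 : Tendsto (fun n : ℕ => h / (n + 1 : ℝ)) atTop (𝓝 0) := by
    have := (tendsto_one_div_add_atTop_nhds_zero_nat (𝕜 := ℝ)).const_mul h
    simpa [div_eq_mul_inv] using this
  have hmem : ∀ n : ℕ, P.memLPhi (u + (h / (n + 1 : ℝ)) • w) := fun n =>
    P.mem_add hu (P.mem_smul hw (hs n))
  let F : ℕ → T → ℝ := fun n t =>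
    (|(u + (h / (n + 1 : ℝ)) • w) t| * β t - |u t| * β t) / (h / (n + 1))
  have hlim : Tendsto (fun n => ∫ t, F n t ∂μ) atTop (𝓝 (∫ t, w t * vf u β ∅ 0 t ∂μ)) := by
    refine tendsto_integral_of_dominated_convergence (fun t => |w t| * β t) ?_
      (P.integrable_abs_beta hu.1 hβ hc hw) ?_ ?_
    · intro n
      exact (((P.integrable_abs_beta hu.1 hβ hc (hmem n)).sub
        (P.integrable_abs_beta hu.1 hβ hc hu)).div_const _).aestronglyMeasurable
    · intro n
      refine Eventually.of_forall fun t => ?_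
      simp only [F]
      rw [← sub_mul, Real.norm_eq_abs, abs_div, abs_of_pos (hs n), div_le_iff₀ (hs n), abs_mul,
        abs_of_nonneg (hβ.nonneg t)]
      have h1 := abs_abs_sub_abs_le ((u + (h / (n + 1 : ℝ)) • w) t) (u t)
      have h2 : (u + (h / (n + 1 : ℝ)) • w) t - u t = (h / (n + 1 : ℝ)) * w t := by simp
      rw [h2, abs_mul, abs_of_pos (hs n)] at h1
      calc _ ≤ (h / (n + 1 : ℝ) * |w t|) * β t := mul_le_mul_of_nonneg_right h1 (hβ.nonneg t)
        _ = _ := by ring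
    · refine Eventually.of_forall fun t => ?_
      by_cases hut : u t = 0
      · simp [F, vf, hut, hβ.off t hut]
      have h1 : Tendsto (fun n : ℕ => |h / (n + 1 : ℝ) * w t|) atTop (𝓝 0) := by
        simpa using (hlim0.mul_const (w t)).abs
      refine tendsto_const_nhds.congr' ?_
      filter_upwards [h1.eventually (gt_mem_nhds (abs_pos.2 hut))] with n hn
      have hsn := hs n
      simp only [F, vf]
      simp only [Pi.add_apply, Pi.smul_apply, smul_eq_mul, Set.indicator_empty, add_zero]
      set s := h / (n + 1 : ℝ) with hsdef
      rw [eq_div_iff hsn.ne']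
      rcases lt_or_gt_of_ne hut with h0 | h0
      · rw [abs_of_neg h0] at hn ⊢
        have := (abs_lt.1 hn).2
        rw [abs_of_neg (by linarith), div_neg, div_self hut]; ring
      · rw [abs_of_pos h0] at hn ⊢
        have := (abs_lt.1 hn).1
        rw [abs_of_pos (by linarith), div_self hut]; ring
  refine ge_of_tendsto (hlim.add_const ε) ?_
  filter_upwards [hev] with n hn
  have h1 := P.support_le hf.1 (hmem n)
  rw [map_add, map_smul, smul_eq_mul, hf.2, P.orlicz_u hu hβ hc] at h1
  have h2 : ∫ t, F n t ∂μ = (∫ t, |(u + (h / (n + 1 : ℝ)) • w) t| * β t ∂μ -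
      ∫ t, |u t| * β t ∂μ) / (h / (n + 1)) := by
    rw [← integral_sub (P.integrable_abs_beta hu.1 hβ hc (hmem n))
        (P.integrable_abs_beta hu.1 hβ hc hu), ← integral_div]
  rw [h2, ← sub_le_iff_le_add, le_div_iff₀ (hs n)]
  nlinarith

lemma smooth_of (P : MOFunction T μ) {u β : T → ℝ} (hu : P.memLPhi u) (hβ : Beta P u β)
    (hc : ∫⁻ t in {t | u t ≠ 0}, P.conj t (P.bConj t) ∂μ ≤ 1) (hne : ¬ u =ᵐ[μ] 0)
    (hb : ∀ w, P.memLPhi w → ∀ ε : ℝ, 0 < ε → ∃ h : ℝ, 0 < h ∧ ∀ᶠ n : ℕ in atTop,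
      P.orliczNorm (u + (h / (n + 1)) • w) ≤
        ∫ t, |(u + (h / (n + 1)) • w) t| * β t ∂μ + ε * (h / (n + 1))) :
    P.IsSmoothPoint u := by
  have key : ∀ f : (T → ℝ) →ₗ[ℝ] ℝ, P.IsSupportAt f u → ∀ w, P.memLPhi w →
      f w = ∫ t, w t * vf u β ∅ 0 t ∂μ := by
    intro f hf w hw
    refine le_antisymm (P.support_le_int hu hβ hc hf hw (hb w hw)) ?_
    have := P.support_le_int hu hβ hc hf (P.mem_neg hw) (hb _ (P.mem_neg hw))
    rw [map_neg] at this
    have e : ∫ t, (-w) t * vf u β ∅ 0 t ∂μ = - ∫ t, w t * vf u β ∅ 0 t ∂μ := by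
      rw [← integral_neg]; congr 1; ext t; simp
    rw [e] at this
    linarith
  refine ⟨?_, fun f g hf hg w hw => by rw [key f hf w hw, key g hg w hw]⟩
  obtain ⟨f, hf, -⟩ := P.vf_support hu hβ hc hne MeasurableSet.empty (by simp) (ε := 0) le_rfl
    (by simpa using hc)
  exact ⟨f, hf⟩

lemma exists_h (P : MOFunction T μ) {u w : T → ℝ} (hu : Measurable u) (hw : P.memLPhi w)
    (ha : ∀ᵐ t ∂μ, u t = 0 → P.aConj t = 0) {ε : ℝ} (hε : 0 < ε) :
    ∃ h : ℝ, 0 < h ∧ ∫⁻ t in {t | u t ≠ 0}ᶜ, P.toFun t (ENNReal.ofReal |h * w t|) ∂μ ≤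
      ENNReal.ofReal (ε * h) := by
  obtain ⟨hwm, l, hl, hl2⟩ := hw
  have hS := (meas_supp hu).compl
  have hj : ∀ j : ℕ, (0:ℝ) < j + 1 := fun j => by positivity
  let G : ℕ → T → ℝ≥0∞ := fun j t =>
    ENNReal.ofReal (j + 1) * P.toFun t (ENNReal.ofReal |l / (j + 1) * w t|)
  have hlim : Tendsto (fun j => ∫⁻ t in {t | u t ≠ 0}ᶜ, G j t ∂μ) atTop
      (𝓝 (∫⁻ t in {t | u t ≠ 0}ᶜ, 0 ∂μ)) := by
    refine tendsto_lintegral_of_dominated_convergence'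
      (fun t => P.toFun t (ENNReal.ofReal |l * w t|)) ?_ ?_ ?_ ?_
    · intro j
      exact ((P.aem_toFun (aem_abs (hwm.const_mul _))).const_mul _).restrict
    · intro j
      refine ae_restrict_of_ae ?_
      filter_upwards [P.ae_good] with t Gd
      have h1 := Gd.mono_slope (p := Real.toNNReal (j + 1)) (by simp)
        (ENNReal.ofReal |l / (j + 1) * w t|)
      refine h1.trans (le_of_eq ?_)
      change P.toFun t (ENNReal.ofReal (j + 1) * _) = _
      rw [← ENNReal.ofReal_mul (hj j).le, abs_mul, abs_mul, abs_of_pos hl,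
        abs_of_pos (div_pos hl (hj j))]
      congr 2
      have := (hj j).ne'
      field_simp
    · exact ((setLIntegral_le_lintegral _ _).trans_lt hl2).ne
    · rw [ae_restrict_iff' hS]
      filter_upwards [P.ae_good, ha] with t Gd hat ht
      have hut : u t = 0 := by simpa using ht
      have hat' : aj (P.toFun t) = 0 := hat hut
      rw [ENNReal.tendsto_atTop_zero]
      intro η hη
      obtain ⟨δ, hδ, hδη⟩ := ENNReal.exists_nnreal_pos_mul_lt
        (a := ENNReal.ofReal (l * |w t|)) ofReal_ne_top hη.ne'
      obtain ⟨x, hx, hxφ⟩ := Gd.aj_zero hat' hδ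
      obtain ⟨N, hN⟩ := exists_nat_ge (l * |w t| / x : ℝ)
      refine ⟨N, fun j hjN => ?_⟩
      have hx' : (0:ℝ) < x := by exact_mod_cast hx
      have hjN' : (N:ℝ) ≤ j := by exact_mod_cast hjN
      have h1 := hxφ (Real.toNNReal |l / (j + 1) * w t|) (by
        rw [Real.toNNReal_le_iff_le_coe, abs_mul, abs_of_pos (div_pos hl (hj j)),
          div_mul_eq_mul_div, div_le_iff₀ (hj j)]
        rw [div_le_iff₀ hx'] at hN
        nlinarith)
      refine le_trans ?_ hδη.le
      calc G j t ≤ ENNReal.ofReal (j + 1) * (ENNReal.ofReal |l / (j + 1) * w t| * δ) := by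
            simp only [G]; gcongr; exact h1
        _ = _ := by
          rw [← mul_assoc, ← ENNReal.ofReal_mul (hj j).le, mul_comm (δ : ℝ≥0∞)]
          congr 2
          rw [abs_mul, abs_of_pos (div_pos hl (hj j))]
          have := (hj j).ne'
          field_simp
  rw [lintegral_zero] at hlim
  have hpos : (0:ℝ≥0∞) < ENNReal.ofReal (ε * l) := by simp; positivity
  obtain ⟨j, hjj⟩ := (hlim.eventually (gt_mem_nhds hpos)).exists
  refine ⟨l / (j + 1), div_pos hl (hj j), ?_⟩
  simp only [G] at hjj
  rw [lintegral_const_mul' _ _ ofReal_ne_top] at hjj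
  have h0 : ENNReal.ofReal ((j : ℝ) + 1) ≠ 0 := by simpa using hj j
  rw [← ENNReal.mul_le_mul_iff_right h0 ofReal_ne_top, ← ENNReal.ofReal_mul (hj j).le]
  refine hjj.le.trans (le_of_eq ?_)
  congr 1
  have := (hj j).ne'
  field_simp

lemma case_one (P : MOFunction T μ) {u β w : T → ℝ} (hu : P.memLPhi u) (hβ : Beta P u β)
    (hc : ∫⁻ t in {t | u t ≠ 0}, P.conj t (P.bConj t) ∂μ = 1)
    (ha : ∀ᵐ t ∂μ, u t = 0 → P.aConj t = 0) (hw : P.memLPhi w) {ε : ℝ} (hε : 0 < ε) :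
    ∃ h : ℝ, 0 < h ∧ ∀ᶠ n : ℕ in atTop,
      P.orliczNorm (u + (h / (n + 1)) • w) ≤
        ∫ t, |(u + (h / (n + 1)) • w) t| * β t ∂μ + ε * (h / (n + 1)) := by
  obtain ⟨h, hh, hO⟩ := P.exists_h hu.1 hw ha (half_pos hε)
  refine ⟨h, hh, ?_⟩
  have hS := meas_supp hu.1
  have hj : ∀ j : ℕ, (0:ℝ) < j + 1 := fun j => by positivity
  let y : ℕ → T → ℝ := fun n t => (n + 1 : ℝ) * u t + h * w t
  have hym : ∀ n, Measurable (y n) := fun n => (hu.1.const_mul _).add (hw.1.const_mul _)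
  let R : ℕ → T → ℝ≥0∞ := fun n t => P.conj t (P.bConj t) + P.toFun t (ENNReal.ofReal |y n t|) -
    ENNReal.ofReal |y n t| * P.bConj t
  have hRm : ∀ n, AEMeasurable (R n) μ := fun n =>
    ((P.aem_conj P.aem_b).add (P.aem_toFun (aem_abs (hym n)))).sub ((aem_abs (hym n)).mul P.aem_b)
  have hlim : Tendsto (fun n => ∫⁻ t in {t | u t ≠ 0}, R n t ∂μ) atTop
      (𝓝 (∫⁻ t in {t | u t ≠ 0}, 0 ∂μ)) := by
    refine tendsto_lintegral_of_dominated_convergence' (fun t => P.conj t (P.bConj t))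
      (fun n => (hRm n).restrict) ?_ (by rw [hc]; exact one_ne_top) ?_
    · intro n
      refine ae_restrict_of_ae ?_
      filter_upwards [P.ae_good] with t G
      simp only [R]
      rw [tsub_le_iff_right]
      gcongr
      exact G.le_mul_bj _
    · rw [ae_restrict_iff' hS]
      filter_upwards [P.ae_good, hβ.fin] with t G hfin hut
      rw [ENNReal.tendsto_atTop_zero]
      intro η hη
      obtain ⟨x₀, hx₀⟩ := G.tail (hfin hut) hη
      have hut' : 0 < |u t| := abs_pos.2 hut
      obtain ⟨N, hN⟩ := exists_nat_ge ((x₀ + |h * w t|) / |u t| : ℝ)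
      refine ⟨N, fun n hn => ?_⟩
      simp only [R]
      rw [tsub_le_iff_left]
      refine hx₀ (Real.toNNReal |y n t|) ?_
      rw [← NNReal.coe_le_coe, Real.coe_toNNReal _ (abs_nonneg _)]
      have hn' : (N:ℝ) ≤ n := by exact_mod_cast hn
      rw [div_le_iff₀ hut'] at hN
      have h1 : |(n + 1 : ℝ) * u t| ≤ |y n t| + |h * w t| := by
        have := abs_sub (y n t) (h * w t)
        simpa [y] using this
      rw [abs_mul, abs_of_pos (hj n)] at h1
      nlinarith
  rw [lintegral_zero] at hlim
  have hpos : (0:ℝ≥0∞) < ENNReal.ofReal (ε / 2 * h) := by simp; positivity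
  filter_upwards [hlim.eventually (gt_mem_nhds hpos)] with n hn
  have hn1 := hj n
  set x : T → ℝ := u + (h / (n + 1 : ℝ)) • w with hx
  have hxm : P.memLPhi x := P.mem_add hu (P.mem_smul hw (div_pos hh hn1))
  have hxy : ∀ t, (n + 1 : ℝ) * x t = y n t := by
    intro t; simp [hx, y]; field_simp
  set N := ∫ t, |x t| * β t ∂μ with hN
  have hN0 : 0 ≤ N := int_beta_nonneg hβ x
  have hC : 0 ≤ N + ε * (h / (n + 1 : ℝ)) := by positivity
  refine P.orlicz_le hC fun v hv hv1 => abs_int_le hC ?_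
  have h0 : ENNReal.ofReal ((n : ℝ) + 1) ≠ 0 := by simpa using hn1
  rw [← ENNReal.mul_le_mul_iff_right h0 ofReal_ne_top]
  refine (P.young_int hxm.1 hn1).trans ?_
  have hmod : P.modular (fun t => (n + 1 : ℝ) * x t) + P.modularConj v ≤
      ∫⁻ t in {t | u t ≠ 0}, (P.conj t (P.bConj t) + P.toFun t (ENNReal.ofReal |y n t|)) ∂μ +
      ∫⁻ t in {t | u t ≠ 0}ᶜ, P.toFun t (ENNReal.ofReal |h * w t|) ∂μ := by
    rw [lintegral_add_left' (P.aem_conj P.aem_b).restrict, hc]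
    unfold modular
    simp_rw [hxy]
    rw [← lintegral_add_compl (fun t => P.toFun t (ENNReal.ofReal |y n t|)) hS]
    have e : ∫⁻ t in {t | u t ≠ 0}ᶜ, P.toFun t (ENNReal.ofReal |y n t|) ∂μ =
        ∫⁻ t in {t | u t ≠ 0}ᶜ, P.toFun t (ENNReal.ofReal |h * w t|) ∂μ := by
      refine setLIntegral_congr_fun hS.compl fun t ht => ?_
      have hut : u t = 0 := by simpa using ht
      simp [y, hut]
    rw [e]
    refine (add_le_add le_rfl hv1).trans (le_of_eq ?_)
    ring
  refine hmod.trans ?_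
  have hS1 : ∫⁻ t in {t | u t ≠ 0}, (P.conj t (P.bConj t) + P.toFun t (ENNReal.ofReal |y n t|)) ∂μ
      ≤ ENNReal.ofReal (n + 1) * ENNReal.ofReal N + ENNReal.ofReal (ε / 2 * h) := by
    rw [hN, P.ofReal_int_beta hu.1 hβ hc.le hxm, ← lintegral_const_mul' _ _ ofReal_ne_top]
    refine le_trans ?_ (add_le_add le_rfl hn.le)
    rw [← lintegral_add_right' _ (hRm n).restrict]
    refine lintegral_mono fun t => ?_
    have e : ENNReal.ofReal (n + 1) * (ENNReal.ofReal |x t| * P.bConj t) =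
        ENNReal.ofReal |y n t| * P.bConj t := by
      rw [← mul_assoc, ← ENNReal.ofReal_mul hn1.le, ← hxy t, abs_mul, abs_of_pos hn1]
    simp only [e, R]
    exact le_add_tsub
  refine (add_le_add hS1 hO).trans (le_of_eq ?_)
  rw [← ENNReal.ofReal_mul hn1.le, ← ENNReal.ofReal_add (by positivity) (by positivity),
    ← ENNReal.ofReal_add (by positivity) (by positivity), ← ENNReal.ofReal_mul hn1.le]
  congr 1
  field_simp
  ring

end MOFunction

/-- characterization of smooth points when `K(u) = ∅`. -/
theorem stmt17 [SigmaFinite μ] (hna : IsNonatomic μ) (P : MOFunction T μ)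
    (u : T → ℝ) (hu : P.memLPhi u) (hne : ¬ u =ᵐ[μ] 0)
    (hK : P.Kset u = ∅) :
    P.IsSmoothPoint u ↔
      (((∫⁻ t in {t | u t ≠ 0}, P.conj t (P.bConj t) ∂μ) = 1 ∧
        ∀ᵐ t ∂μ, u t = 0 → P.aConj t = 0) ∨
       ((∫⁻ t, P.conj t (P.bConj t) ∂μ) < 1 ∧ μ {t | u t = 0} = 0)) := by
  have hc := P.key_le_one hu hK
  refine ⟨P.smooth_imp hu hc hne, ?_⟩
  obtain ⟨β, hβ⟩ := P.exists_beta hu.1 hc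
  rintro (⟨h1, ha⟩ | ⟨-, h0⟩)
  · exact P.smooth_of hu hβ hc hne fun w hw ε hε => P.case_one hu hβ h1 ha hw hε
  · refine P.smooth_of hu hβ hc hne fun w hw ε hε => ⟨1, one_pos, Eventually.of_forall fun n => ?_⟩
    have hs : (0:ℝ) < 1 / (n + 1) := by positivity
    have h2 := P.orlicz_le_beta hu.1 hβ hc (P.mem_add hu (P.mem_smul hw hs)) (by
      filter_upwards [measure_eq_zero_iff_ae_notMem.1 h0] with t ht hut
      exact absurd hut ht)
    have : 0 < ε * (1 / ((n : ℝ) + 1)) := mul_pos hε hs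
    linarith
end
end
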